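/- arXiv:0810.3255 — 8 statements merged into one kernel-verified Lean document; each statement's English description precedes it below -/
import Mathlib

section
/- Let R₀ > 0 and let ω : ℝ² → ℝ be a continuous function with support contained in the closed ball B(0,R₀) and with ∫_{ℝ²} ω(y) dy = 0. Define v : ℝ² → ℝ² by v(x) = (1/(2π)) ∫_{ℝ²} ((x−y)^⊥ / |x−y|²) ω(y) dy. Then there exists a constant C > 0, depending only on R₀, such that for every x ∈ ℝ² with |x| ≥ 2R₀ one has |v(x)| ≤ C ‖ω‖_{L¹(ℝ²)} / |x|². -/
open MeasureTheory Real

/-- The perpendicular `z^⊥ = (-z₂, z₁)` of a vector in `ℝ²`. -/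
noncomputable def perp (z : EuclideanSpace ℝ (Fin 2)) : EuclideanSpace ℝ (Fin 2) :=
  (EuclideanSpace.equiv (Fin 2) ℝ).symm ![-z 1, z 0]

/-- The two-dimensional Biot–Savart law
`v(x) = (1/(2π)) ∫ ((x−y)^⊥/|x−y|²) ω(y) dy`. -/
noncomputable def biotSavart2D (ω : EuclideanSpace ℝ (Fin 2) → ℝ)
    (x : EuclideanSpace ℝ (Fin 2)) : EuclideanSpace ℝ (Fin 2) :=
  (1 / (2 * π)) • ∫ y, (ω y / ‖x - y‖ ^ 2) • perp (x - y)

lemma kernel_diff (a b : EuclideanSpace ℝ (Fin 2)) (ha : 0 < ‖a‖) (hb : 0 < ‖b‖) :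
    ‖(1 / ‖a‖ ^ 2) • perp a - (1 / ‖b‖ ^ 2) • perp b‖ = ‖a - b‖ / (‖a‖ * ‖b‖) := by
  have h2 : ∀ z : EuclideanSpace ℝ (Fin 2), ‖z‖ ^ 2 = z 0 ^ 2 + z 1 ^ 2 := by
    intro z
    simp [EuclideanSpace.norm_sq_eq, Fin.sum_univ_two]
  have p0 : ∀ z : EuclideanSpace ℝ (Fin 2), perp z 0 = - z 1 := fun z => by simp [perp]
  have p1 : ∀ z : EuclideanSpace ℝ (Fin 2), perp z 1 = z 0 := fun z => by simp [perp]
  have hA := h2 a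
  have hB := h2 b
  have hA0 : 0 < a 0 ^ 2 + a 1 ^ 2 := by rw [← hA]; positivity
  have hB0 : 0 < b 0 ^ 2 + b 1 ^ 2 := by rw [← hB]; positivity
  rw [← sq_eq_sq₀ (norm_nonneg _) (by positivity), div_pow, mul_pow, h2, h2 (a - b)]
  simp only [PiLp.sub_apply, PiLp.smul_apply, smul_eq_mul, p0, p1, hA, hB]
  field_simp
  ring

theorem biotSavart2D_decay (R₀ : ℝ) (hR₀ : 0 < R₀) :
    ∃ C > 0, ∀ ω : EuclideanSpace ℝ (Fin 2) → ℝ,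
      Continuous ω →
      Function.support ω ⊆ Metric.closedBall 0 R₀ →
      (∫ y, ω y) = 0 →
      ∀ x : EuclideanSpace ℝ (Fin 2), 2 * R₀ ≤ ‖x‖ →
        ‖biotSavart2D ω x‖ ≤ C * (∫ y, |ω y|) / ‖x‖ ^ 2 := by
  refine ⟨2 * R₀, by positivity, ?_⟩
  intro ω hc hs h0 x hx
  have hx0 : 0 < ‖x‖ := by linarith
  have hcs : HasCompactSupport ω :=
    HasCompactSupport.of_support_subset_isCompact (isCompact_closedBall _ _) hs
  have hint : Integrable ω := hc.integrable_of_hasCompactSupport hcs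
  have hI : 0 ≤ ∫ y, |ω y| := integral_nonneg fun _ => abs_nonneg _
  have key : ‖∫ y, (ω y / ‖x - y‖ ^ 2) • perp (x - y)‖ ≤ 2 * R₀ * (∫ y, |ω y|) / ‖x‖ ^ 2 := by
    by_cases hi : Integrable (fun y => (ω y / ‖x - y‖ ^ 2) • perp (x - y))
    · have hz : ∫ y, ω y • ((1 / ‖x‖ ^ 2) • perp x) = 0 := by
        rw [integral_smul_const, h0, zero_smul]
      rw [← sub_zero (∫ y, (ω y / ‖x - y‖ ^ 2) • perp (x - y)), ← hz,
        ← integral_sub hi (hint.smul_const _)]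
      have e : 2 * R₀ * (∫ y, |ω y|) / ‖x‖ ^ 2 = ∫ y, (2 * R₀ / ‖x‖ ^ 2) * |ω y| := by
        rw [integral_const_mul]; ring
      rw [e]
      refine norm_integral_le_of_norm_le (hint.abs.const_mul _) (Filter.Eventually.of_forall ?_)
      intro y
      by_cases hy : ω y = 0
      · simp [hy]
      have hyR : ‖y‖ ≤ R₀ := by simpa using hs (Function.mem_support.2 hy)
      have hxy : ‖x‖ / 2 ≤ ‖x - y‖ := by
        have := norm_sub_norm_le x y
        linarith
      have hxy0 : 0 < ‖x - y‖ := by linarith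
      have e2 : (ω y / ‖x - y‖ ^ 2) • perp (x - y) - ω y • ((1 / ‖x‖ ^ 2) • perp x)
          = ω y • ((1 / ‖x - y‖ ^ 2) • perp (x - y) - (1 / ‖x‖ ^ 2) • perp x) := by
        rw [smul_sub, smul_smul (ω y) (1 / ‖x - y‖ ^ 2), mul_one_div]
      rw [e2, norm_smul, kernel_diff _ _ hxy0 hx0, Real.norm_eq_abs, mul_comm]
      refine mul_le_mul_of_nonneg_right ?_ (abs_nonneg _)
      have e3 : ‖x - y - x‖ = ‖y‖ := by rw [sub_sub_cancel_left, norm_neg]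
      rw [e3]
      calc ‖y‖ / (‖x - y‖ * ‖x‖) ≤ R₀ / (‖x‖ / 2 * ‖x‖) := by gcongr
        _ = 2 * R₀ / ‖x‖ ^ 2 := by field_simp
    · rw [integral_undef hi, norm_zero]; positivity
  unfold biotSavart2D
  rw [norm_smul]
  refine le_trans (mul_le_of_le_one_left (norm_nonneg _) ?_) key
  rw [Real.norm_of_nonneg (by positivity), div_le_one (by positivity)]
  linarith [Real.pi_gt_three]
end

section
/- Let R₀ > 0 and let ω : ℝ² → ℝ be a continuous function with support contained in the closed ball B(0,R₀) and with ∫_{ℝ²} ω(y) dy = 0. Define v : ℝ² → ℝ² by v(x) = (1/(2π)) ∫_{ℝ²} ((x−y)^⊥ / |x−y|²) ω(y) dy. Then v is differentiable at every x ∈ ℝ² with |x| ≥ 2R₀, and there exists a constant C > 0, depending only on R₀, such that for every such x the Fréchet derivative satisfies ‖Dv(x)‖ ≤ C ‖ω‖_{L¹(ℝ²)} / |x|³. -/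
open MeasureTheory Real

abbrev E2 := EuclideanSpace ℝ (Fin 2)

noncomputable def perpL : E2 →L[ℝ] E2 :=
  LinearMap.toContinuousLinearMap
    { toFun := perp
      map_add' := by
        intro x y; ext i; fin_cases i <;> simp [perp] ; ring
      map_smul' := by
        intro c x; ext i; fin_cases i <;> simp [perp] }

lemma perpL_apply (z : E2) : perpL z = perp z := rfl

lemma norm_perp (z : E2) : ‖perp z‖ = ‖z‖ := by
  simp [EuclideanSpace.norm_eq, perp, Fin.sum_univ_two, add_comm]

lemma norm_perpL_le : ‖perpL‖ ≤ 1 :=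
  ContinuousLinearMap.opNorm_le_bound _ zero_le_one fun z => by
    rw [perpL_apply, norm_perp, one_mul]

noncomputable def gU (z : E2) : E2 := (‖z‖ ^ 2)⁻¹ • z

noncomputable def gL (u : E2) : E2 →L[ℝ] E2 :=
  (‖u‖ ^ 2) • perpL - (2 : ℝ) • (innerSL ℝ u).smulRight (perpL u)

lemma zsm (A : E2 →L[ℝ] E2) : (0 : ℝ) • A = 0 := zero_smul ℝ A

lemma gL_apply (u h : E2) :
    gL u h = (‖u‖ ^ 2) • perpL h - (2 : ℝ) • (inner ℝ u h • perpL u) := rfl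

lemma gL_sub (u w : E2) : ‖gL u - gL w‖ ≤ 3 * ((‖u‖ + ‖w‖) * ‖u - w‖) := by
  refine ContinuousLinearMap.opNorm_le_bound _ (by positivity) fun h => ?_
  have e : (gL u - gL w) h = (‖u‖ ^ 2 - ‖w‖ ^ 2) • perpL h
      - (2 : ℝ) • (inner ℝ (u - w) h • perpL u + inner ℝ w h • perpL (u - w)) := by
    rw [sub_apply, gL_apply, gL_apply, inner_sub_left, map_sub]
    module
  rw [e]
  have h1 : |‖u‖ ^ 2 - ‖w‖ ^ 2| ≤ (‖u‖ + ‖w‖) * ‖u - w‖ := by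
    rw [sq_sub_sq, abs_mul, abs_of_nonneg (by positivity)]
    gcongr
    exact abs_norm_sub_norm_le u w
  calc _ ≤ |‖u‖ ^ 2 - ‖w‖ ^ 2| * ‖h‖
        + 2 * (|inner ℝ (u - w) h| * ‖u‖ + |inner ℝ w h| * ‖u - w‖) := by
        refine (norm_sub_le _ _).trans ?_
        rw [norm_smul, norm_smul, perpL_apply, norm_perp, Real.norm_eq_abs, Real.norm_eq_abs]
        rw [abs_of_pos (two_pos : (0:ℝ) < 2)]
        gcongr
        refine (norm_add_le _ _).trans ?_
        rw [norm_smul, norm_smul, perpL_apply, norm_perp, perpL_apply, norm_perp,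
          Real.norm_eq_abs, Real.norm_eq_abs]
    _ ≤ ((‖u‖ + ‖w‖) * ‖u - w‖) * ‖h‖
        + 2 * ((‖u - w‖ * ‖h‖) * ‖u‖ + (‖w‖ * ‖h‖) * ‖u - w‖) := by
        gcongr
        · exact abs_real_inner_le_norm _ _
        · exact abs_real_inner_le_norm _ _
    _ = _ := by ring

lemma gL_norm (u : E2) : ‖gL u‖ ≤ 3 * ‖u‖ ^ 2 := by
  have h := gL_sub u 0
  have h0 : gL 0 = 0 := by ext; simp [gL]
  rw [h0] at h
  simpa [sq] using h

lemma gL_cont : Continuous gL := by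
  unfold gL
  refine Continuous.sub (by fun_prop) (Continuous.fun_const_smul ?_ (2 : ℝ))
  have : (fun u : E2 => (innerSL ℝ u).smulRight (perpL u)) =
    fun u => ContinuousLinearMap.smulRightL ℝ E2 E2 (innerSL ℝ u) (perpL u) := rfl
  rw [this]
  fun_prop

lemma gU_norm {z : E2} (hz : z ≠ 0) : ‖gU z‖ = 1 / ‖z‖ := by
  have : ‖z‖ ≠ 0 := norm_ne_zero_iff.2 hz
  rw [gU, norm_smul, norm_inv, norm_pow, norm_norm]
  field_simp

lemma gU_sub {z w : E2} (hz : z ≠ 0) (hw : w ≠ 0) :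
    ‖gU z - gU w‖ = ‖z - w‖ / (‖z‖ * ‖w‖) := by
  have h1 : 0 < ‖z‖ := norm_pos_iff.2 hz
  have h2 : 0 < ‖w‖ := norm_pos_iff.2 hw
  rw [← sq_eq_sq₀ (by positivity) (by positivity), div_pow, norm_sub_sq_real, norm_sub_sq_real,
    gU_norm hz, gU_norm hw, gU, gU, real_inner_smul_left, real_inner_smul_right]
  field_simp
  ring

lemma gU_meas : Measurable gU := by
  unfold gU; fun_prop

lemma kernel_deriv {z : E2} (hz : z ≠ 0) :
    HasFDerivAt (fun z : E2 => (‖z‖ ^ 2)⁻¹ • perp z) (gL (gU z)) z := by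
  have h0 : ‖z‖ ≠ 0 := norm_ne_zero_iff.2 hz
  have h1 := (hasStrictFDerivAt_norm_sq z).hasFDerivAt
  have h2 := (hasDerivAt_inv (pow_ne_zero 2 h0)).comp_hasFDerivAt z h1
  have h3 := h2.smul (perpL.hasFDerivAt (x := z))
  refine h3.congr_fderiv ?_
  ext1 h
  rw [gL_apply, gU_norm hz]
  simp [gU, real_inner_smul_left]
  match_scalars <;> field_simp

lemma F_eq (ω : E2 → ℝ) (x y : E2) :
    (ω y / ‖x - y‖ ^ 2) • perp (x - y) = ω y • ((‖x - y‖ ^ 2)⁻¹ • perp (x - y)) := by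
  rw [smul_smul, div_eq_mul_inv]

lemma integral_deriv (R₀ : ℝ) (hR₀ : 0 < R₀) (ω : E2 → ℝ) (hi : Integrable ω)
    (hs : Function.support ω ⊆ Metric.closedBall 0 R₀) (x : E2) (hx : 2 * R₀ ≤ ‖x‖) :
    HasFDerivAt (fun x => ∫ y, (ω y / ‖x - y‖ ^ 2) • perp (x - y))
      (∫ y, ω y • gL (gU (x - y))) x := by
  have hlow : ∀ x' ∈ Metric.ball x (R₀ / 2), ∀ y, ω y ≠ 0 → R₀ / 2 ≤ ‖x' - y‖ := by
    intro x' hx' y hy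
    have h1 : ‖y‖ ≤ R₀ := by simpa using hs hy
    have h2 : ‖x' - x‖ < R₀ / 2 := by simpa [dist_eq_norm] using hx'
    have h3 : ‖x‖ ≤ ‖x' - y‖ + ‖y‖ + ‖x' - x‖ := by
      have : x = (x' - y) + y - (x' - x) := by abel
      calc ‖x‖ = ‖(x' - y) + y - (x' - x)‖ := by rw [← this]
        _ ≤ ‖(x' - y) + y‖ + ‖x' - x‖ := norm_sub_le _ _
        _ ≤ _ := by gcongr; exact norm_add_le _ _
    linarith
  have hpm : Measurable perp := perpL.continuous.measurable
  have hFm : ∀ x' : E2, AEStronglyMeasurable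
      (fun y => (ω y / ‖x' - y‖ ^ 2) • perp (x' - y)) volume := by
    intro x'
    simp_rw [F_eq]
    refine hi.aestronglyMeasurable.smul (Measurable.aestronglyMeasurable ?_)
    have := hpm.comp (measurable_const.sub measurable_id : Measurable fun y => x' - y)
    have h2 : Measurable fun y : E2 => (‖x' - y‖ ^ 2)⁻¹ := by fun_prop
    exact h2.smul this
  refine hasFDerivAt_integral_of_dominated_of_fderiv_le
    (F := fun x y => (ω y / ‖x - y‖ ^ 2) • perp (x - y))
    (F' := fun x y => ω y • gL (gU (x - y)))
    (bound := fun y => ‖ω y‖ * (3 * (1 / (R₀ / 2)) ^ 2))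
    (s := Metric.ball x (R₀ / 2)) (Metric.ball_mem_nhds x (by positivity))
    (Filter.Eventually.of_forall hFm) ?_ ?_ ?_ ?_ ?_
  · refine (hi.norm.mul_const (1 / (R₀ / 2))).mono' (hFm x) (Filter.Eventually.of_forall ?_)
    intro y
    by_cases hy : ω y = 0
    · simp [hy]
    have hl := hlow x (Metric.mem_ball_self (by positivity)) y hy
    have hp : 0 < ‖x - y‖ := by linarith
    rw [F_eq, norm_smul, norm_smul, norm_perp, norm_inv, norm_pow, norm_norm]
    gcongr
    rw [show (‖x - y‖ ^ 2)⁻¹ * ‖x - y‖ = 1 / ‖x - y‖ by field_simp]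
    gcongr
  · refine hi.aestronglyMeasurable.smul ?_
    have : Measurable fun y => gU (x - y) := gU_meas.comp (by fun_prop)
    exact gL_cont.comp_aestronglyMeasurable this.aestronglyMeasurable
  · refine Filter.Eventually.of_forall fun y x' hx' => ?_
    by_cases hy : ω y = 0
    · simp [hy]
    have hl := hlow x' hx' y hy
    have hp : 0 < ‖x' - y‖ := by linarith
    rw [norm_smul]
    gcongr
    refine (gL_norm _).trans ?_
    rw [gU_norm (norm_pos_iff.1 hp)]
    gcongr
  · exact hi.norm.mul_const _
  · refine Filter.Eventually.of_forall fun y x' hx' => ?_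
    by_cases hy : ω y = 0
    · simpa [hy, zsm] using hasFDerivAt_const (0 : E2) x'
    have hl := hlow x' hx' y hy
    have hp : 0 < ‖x' - y‖ := by linarith
    simp_rw [F_eq]
    have h1 := (kernel_deriv (norm_pos_iff.1 hp)).comp x' ((hasFDerivAt_id x').sub_const y)
    exact (h1.congr_fderiv (by ext1; simp)).const_smul (ω y)

theorem biotSavart2D_grad_decay (R₀ : ℝ) (hR₀ : 0 < R₀) :
    ∃ C > 0, ∀ ω : EuclideanSpace ℝ (Fin 2) → ℝ,
      Continuous ω →
      Function.support ω ⊆ Metric.closedBall 0 R₀ →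
      (∫ y, ω y) = 0 →
      ∀ x : EuclideanSpace ℝ (Fin 2), 2 * R₀ ≤ ‖x‖ →
        DifferentiableAt ℝ (biotSavart2D ω) x ∧
        ‖fderiv ℝ (biotSavart2D ω) x‖ ≤ C * (∫ y, |ω y|) / ‖x‖ ^ 3 := by
  refine ⟨18 * R₀, by positivity, fun ω hc hs h0 x hx => ?_⟩
  have hi : Integrable ω := hc.integrable_of_hasCompactSupport
    (HasCompactSupport.of_support_subset_isCompact (isCompact_closedBall 0 R₀) hs)
  have hd : HasFDerivAt (biotSavart2D ω) ((1 / (2 * π)) • ∫ y, ω y • gL (gU (x - y))) x :=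
    (integral_deriv R₀ hR₀ ω hi hs x hx).const_smul (1 / (2 * π))
  refine ⟨hd.differentiableAt, ?_⟩
  rw [hd.fderiv, norm_smul]
  have hxp : 0 < ‖x‖ := by linarith
  have hb : ∀ y, ‖ω y • (gL (gU (x - y)) - gL (gU x))‖ ≤ |ω y| * (18 * R₀ / ‖x‖ ^ 3) := by
    intro y
    by_cases hy : ω y = 0
    · simp [hy, zsm]
    have h1 : ‖y‖ ≤ R₀ := by simpa using hs hy
    have hl : ‖x‖ / 2 ≤ ‖x - y‖ := by
      have := norm_sub_norm_le x y
      linarith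
    have hp : 0 < ‖x - y‖ := by linarith
    rw [norm_smul, Real.norm_eq_abs]
    gcongr
    refine (gL_sub _ _).trans ?_
    rw [gU_norm (norm_pos_iff.1 hp), gU_norm (norm_pos_iff.1 hxp),
      gU_sub (norm_pos_iff.1 hp) (norm_pos_iff.1 hxp), show x - y - x = -y by abel, norm_neg]
    calc 3 * ((1 / ‖x - y‖ + 1 / ‖x‖) * (‖y‖ / (‖x - y‖ * ‖x‖)))
        ≤ 3 * ((1 / (‖x‖ / 2) + 1 / ‖x‖) * (R₀ / (‖x‖ / 2 * ‖x‖))) := by gcongr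
      _ = 18 * R₀ / ‖x‖ ^ 3 := by field_simp; norm_num
  have hm : AEStronglyMeasurable (fun y => ω y • (gL (gU (x - y)) - gL (gU x))) volume := by
    refine hi.aestronglyMeasurable.smul ?_
    have : Measurable fun y => gU (x - y) := gU_meas.comp (by fun_prop)
    exact (gL_cont.comp_aestronglyMeasurable this.aestronglyMeasurable).sub
      aestronglyMeasurable_const
  have hbi : Integrable (fun y => |ω y| * (18 * R₀ / ‖x‖ ^ 3)) := hi.abs.mul_const _
  have hint := hbi.mono' hm (Filter.Eventually.of_forall hb)
  have e : ∫ y, ω y • gL (gU (x - y)) = ∫ y, ω y • (gL (gU (x - y)) - gL (gU x)) := by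
    have : ∀ y, ω y • gL (gU (x - y))
        = ω y • (gL (gU (x - y)) - gL (gU x)) + ω y • gL (gU x) := by
      intro y; module
    simp_rw [this]
    rw [integral_add hint (hi.smul_const _), integral_smul_const, h0, zsm, add_zero]
  have hn : ‖∫ y, ω y • gL (gU (x - y))‖ ≤ (∫ y, |ω y|) * (18 * R₀ / ‖x‖ ^ 3) := by
    rw [e, ← integral_mul_const]
    exact norm_integral_le_of_norm_le hbi (Filter.Eventually.of_forall hb)
  have hpi : ‖1 / (2 * π)‖ ≤ 1 := by
    rw [Real.norm_of_nonneg (by positivity), div_le_one (by positivity)]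
    linarith [Real.pi_gt_three]
  calc _ ≤ 1 * ((∫ y, |ω y|) * (18 * R₀ / ‖x‖ ^ 3)) := by gcongr
    _ = _ := by ring
end

section
/- Let R₀ > 0 and let ω : ℝ² → ℝ be a continuous function with support contained in the closed ball B(0,R₀) and with ∫_{ℝ²} ω(y) dy = 0. Define the stream function ψ : ℝ² → ℝ by ψ(x) = (1/(2π)) ∫_{ℝ²} log|x−y| ω(y) dy. Then there exists a constant C > 0, depending only on R₀, such that for every x ∈ ℝ² with |x| ≥ 2R₀ one has |ψ(x)| ≤ C ‖ω‖_{L¹(ℝ²)} / |x|. -/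
open MeasureTheory Real

/-- The two-dimensional stream function
`ψ(x) = (1/(2π)) ∫ log|x−y| ω(y) dy`. -/
noncomputable def streamFn2D (ω : EuclideanSpace ℝ (Fin 2) → ℝ)
    (x : EuclideanSpace ℝ (Fin 2)) : ℝ :=
  (1 / (2 * π)) * ∫ y, Real.log ‖x - y‖ * ω y

theorem streamFn2D_decay (R₀ : ℝ) (hR₀ : 0 < R₀) :
    ∃ C > 0, ∀ ω : EuclideanSpace ℝ (Fin 2) → ℝ,
      Continuous ω →
      Function.support ω ⊆ Metric.closedBall 0 R₀ →
      (∫ y, ω y) = 0 →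
      ∀ x : EuclideanSpace ℝ (Fin 2), 2 * R₀ ≤ ‖x‖ →
        |streamFn2D ω x| ≤ C * (∫ y, |ω y|) / ‖x‖ := by
  refine ⟨1 / (2 * π) * (2 * R₀), by positivity, ?_⟩
  intro ω hc hs h0 x hx
  have hxp : 0 < ‖x‖ := by linarith
  have hcs : HasCompactSupport ω :=
    HasCompactSupport.of_support_subset_isCompact (isCompact_closedBall 0 R₀) hs
  have hi : Integrable ω := hc.integrable_of_hasCompactSupport hcs
  have key : ∀ y, ‖y‖ ≤ R₀ → |Real.log ‖x - y‖ - Real.log ‖x‖| ≤ 2 * R₀ / ‖x‖ := by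
    intro y hy
    have h1 : ‖x‖ - ‖y‖ ≤ ‖x - y‖ := norm_sub_norm_le x y
    have h2 : ‖x - y‖ ≤ ‖x‖ + ‖y‖ := norm_sub_le x y
    have hp : 0 < ‖x - y‖ := by linarith
    rw [abs_le]
    constructor
    · have := Real.log_le_sub_one_of_pos (div_pos hxp hp)
      rw [Real.log_div hxp.ne' hp.ne'] at this
      have h3 : ‖x‖ / ‖x - y‖ - 1 ≤ 2 * R₀ / ‖x‖ := by
        rw [div_sub_one hp.ne', div_le_div_iff₀ hp hxp]
        nlinarith
      linarith
    · have := Real.log_le_sub_one_of_pos (div_pos hp hxp)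
      rw [Real.log_div hp.ne' hxp.ne'] at this
      have h3 : ‖x - y‖ / ‖x‖ - 1 ≤ 2 * R₀ / ‖x‖ := by
        rw [div_sub_one hxp.ne']
        gcongr
        linarith
      linarith
  have main : |∫ y, Real.log ‖x - y‖ * ω y| ≤ 2 * R₀ / ‖x‖ * ∫ y, |ω y| := by
    by_cases hint : Integrable (fun y => Real.log ‖x - y‖ * ω y)
    · have e : ∫ y, Real.log ‖x - y‖ * ω y
          = ∫ y, (Real.log ‖x - y‖ * ω y - Real.log ‖x‖ * ω y) := by
        rw [integral_sub hint (hi.const_mul _), integral_const_mul, h0]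
        simp
      rw [e, ← integral_const_mul, ← Real.norm_eq_abs]
      refine norm_integral_le_of_norm_le (hi.abs.const_mul _) (Filter.Eventually.of_forall ?_)
      intro y
      rw [Real.norm_eq_abs, ← sub_mul, abs_mul]
      by_cases hy : ω y = 0
      · simp [hy]
      · have hy' : ‖y‖ ≤ R₀ := by simpa using hs hy
        exact mul_le_mul_of_nonneg_right (key y hy') (abs_nonneg _)
    · rw [integral_undef hint, abs_zero]
      have : 0 ≤ ∫ y, |ω y| := integral_nonneg fun y => abs_nonneg _
      positivity
  unfold streamFn2D
  rw [abs_mul, abs_of_pos (by positivity : (0:ℝ) < 1 / (2 * π))]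
  calc _ ≤ 1 / (2 * π) * (2 * R₀ / ‖x‖ * ∫ y, |ω y|) := by gcongr
    _ = _ := by ring
end

section
/- Let φ : ℝ → ℝ be a smooth function whose support is a compact subset of (0,∞). Define σ : ℝ² → ℝ² by σ(x) = (x^⊥/|x|²) ∫₀^{|x|} s φ(s) ds for x ≠ 0 and σ(0) = 0. Then σ is continuously differentiable on ℝ², and for every x ∈ ℝ² it satisfies ∂₁σ¹(x) + ∂₂σ²(x) = 0 (σ is divergence-free) and ∂₁σ²(x) − ∂₂σ¹(x) = φ(|x|) (the scalar curl of σ at x equals φ(|x|)). -/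
open MeasureTheory Real Classical

/-- The radially symmetric stationary Euler flow with vorticity profile `φ`:
`σ(x) = (x^⊥/|x|²) ∫₀^{|x|} s φ(s) ds`, with `σ(0) = 0`. -/
noncomputable def radialFlow (φ : ℝ → ℝ) (x : EuclideanSpace ℝ (Fin 2)) :
    EuclideanSpace ℝ (Fin 2) :=
  if x = 0 then 0 else ((∫ s in (0:ℝ)..‖x‖, s * φ s) / ‖x‖ ^ 2) • perp x

theorem rf_F_deriv (φ : ℝ → ℝ) (hc : Continuous φ) (r : ℝ) :
    HasDerivAt (fun r : ℝ => ∫ s in (0:ℝ)..r, s * φ s) (r * φ r) r := by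
  have h : Continuous fun s : ℝ => s * φ s := continuous_id.mul hc
  exact h.integral_hasStrictDerivAt 0 r |>.hasDerivAt

theorem rf_F_contDiff (φ : ℝ → ℝ) (hc : Continuous φ) :
    ContDiff ℝ 1 (fun r : ℝ => ∫ s in (0:ℝ)..r, s * φ s) := by
  rw [contDiff_one_iff_deriv]
  refine ⟨fun r => (rf_F_deriv φ hc r).differentiableAt, ?_⟩
  have : deriv (fun r : ℝ => ∫ s in (0:ℝ)..r, s * φ s) = fun r => r * φ r :=
    funext fun r => (rf_F_deriv φ hc r).deriv
  rw [this]
  exact continuous_id.mul hc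

/-- The perpendicular map as a continuous linear map. -/
noncomputable def rfPerpL : EuclideanSpace ℝ (Fin 2) →L[ℝ] EuclideanSpace ℝ (Fin 2) :=
  LinearMap.toContinuousLinearMap
    { toFun := perp
      map_add' := by
        intro x y
        ext i
        fin_cases i <;> simp [perp]
        ring
      map_smul' := by
        intro c x
        ext i
        fin_cases i <;> simp [perp] }

theorem rfPerpL_apply (x : EuclideanSpace ℝ (Fin 2)) : rfPerpL x = perp x := rfl

theorem rf_eventually_ne (φ : ℝ → ℝ) (x : EuclideanSpace ℝ (Fin 2)) (hx : x ≠ 0) :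
    radialFlow φ =ᶠ[nhds x]
      fun y => ((∫ s in (0:ℝ)..‖y‖, s * φ s) / ‖y‖ ^ 2) • rfPerpL y := by
  filter_upwards [isOpen_ne.mem_nhds hx] with y hy
  have hy' : y ≠ 0 := hy
  simp [radialFlow, hy', rfPerpL_apply]

theorem rf_eventually_zero (φ : ℝ → ℝ) (hsupp' : tsupport φ ⊆ Set.Ioi (0 : ℝ)) :
    radialFlow φ =ᶠ[nhds 0] fun _ => 0 := by
  have h0 : (0:ℝ) ∉ tsupport φ := fun h => lt_irrefl (0:ℝ) (hsupp' h)
  have h1 : φ =ᶠ[nhds 0] 0 := notMem_tsupport_iff_eventuallyEq.mp h0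
  obtain ⟨ε, hε, h⟩ := Metric.eventually_nhds_iff.mp h1
  filter_upwards [Metric.ball_mem_nhds (0 : EuclideanSpace ℝ (Fin 2)) hε] with y hy
  have hy' : ‖y‖ < ε := by simpa using hy
  have : ∫ s in (0:ℝ)..‖y‖, s * φ s = 0 := by
    apply intervalIntegral.integral_zero_ae
    refine Filter.Eventually.of_forall fun s hs => ?_
    rw [Set.uIoc_of_le (norm_nonneg y)] at hs
    have : φ s = 0 := h (by
      rw [Real.dist_eq, sub_zero, abs_of_pos hs.1]
      exact hs.2.trans_lt hy')
    rw [this, mul_zero]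
  simp [radialFlow, this]

theorem rf_hasFDerivAt (φ : ℝ → ℝ) (hc : Continuous φ) (x : EuclideanSpace ℝ (Fin 2))
    (hx : x ≠ 0) (v : EuclideanSpace ℝ (Fin 2)) :
    fderiv ℝ (radialFlow φ) x v =
      ((∫ s in (0:ℝ)..‖x‖, s * φ s) / ‖x‖ ^ 2) • perp v +
      ((φ ‖x‖ / ‖x‖ ^ 2 - 2 * (∫ s in (0:ℝ)..‖x‖, s * φ s) / ‖x‖ ^ 4) * inner ℝ x v) •
        perp x := by
  have hn : 0 < ‖x‖ := norm_pos_iff.mpr hx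
  have hn2 : ‖x‖ ^ 2 ≠ 0 := by positivity
  have hs : Real.sqrt (‖x‖ ^ 2) = ‖x‖ := Real.sqrt_sq hn.le
  rw [(rf_eventually_ne φ x hx).fderiv_eq]
  have hF := rf_F_deriv φ hc (Real.sqrt (‖x‖ ^ 2))
  have hH := (hF.comp (‖x‖ ^ 2) (Real.hasDerivAt_sqrt hn2)).div (hasDerivAt_id (‖x‖ ^ 2)) hn2
  have hq := (hasStrictFDerivAt_norm_sq x).hasFDerivAt
  have hg := (HasDerivAt.comp_hasFDerivAt x hH hq).smul rfPerpL.hasFDerivAt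
  have hfd := HasFDerivAt.fderiv (hg.congr_of_eventuallyEq
    (f₁ := fun y => ((∫ s in (0:ℝ)..‖y‖, s * φ s) / ‖y‖ ^ 2) • rfPerpL y)
    (Filter.Eventually.of_forall fun y => by
      simp [Function.comp, Real.sqrt_sq (norm_nonneg y)]))
  rw [hfd]
  simp only [ContinuousLinearMap.add_apply, ContinuousLinearMap.smul_apply,
    ContinuousLinearMap.smulRight_apply, rfPerpL_apply, Function.comp, id, hs,
    innerSL_apply_apply, smul_eq_mul, Pi.div_apply]
  congr 2
  simp only [nsmul_eq_mul]
  field_simp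
  push_cast
  ring

theorem radialFlow_c1_divFree_curl (φ : ℝ → ℝ)
    (hφ : ContDiff ℝ (⊤ : ℕ∞) φ)
    (hsupp : IsCompact (tsupport φ))
    (hsupp' : tsupport φ ⊆ Set.Ioi (0 : ℝ)) :
    ContDiff ℝ 1 (radialFlow φ) ∧
    ∀ x : EuclideanSpace ℝ (Fin 2),
      (fderiv ℝ (radialFlow φ) x (EuclideanSpace.single 0 1)) 0 +
        (fderiv ℝ (radialFlow φ) x (EuclideanSpace.single 1 1)) 1 = 0 ∧
      (fderiv ℝ (radialFlow φ) x (EuclideanSpace.single 0 1)) 1 -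
        (fderiv ℝ (radialFlow φ) x (EuclideanSpace.single 1 1)) 0 = φ ‖x‖ := by
  have hc := hφ.continuous
  constructor
  · rw [contDiff_iff_contDiffAt]
    intro x
    by_cases hx : x = 0
    · subst hx
      exact contDiffAt_const.congr_of_eventuallyEq (rf_eventually_zero φ hsupp')
    · refine ContDiffAt.congr_of_eventuallyEq ?_ (rf_eventually_ne φ x hx)
      have hnorm : ContDiffAt ℝ 1 (fun y : EuclideanSpace ℝ (Fin 2) => ‖y‖) x :=
        contDiffAt_norm ℝ hx
      have hF : ContDiffAt ℝ 1
          (fun y : EuclideanSpace ℝ (Fin 2) => ∫ s in (0:ℝ)..‖y‖, s * φ s) x :=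
        ((rf_F_contDiff φ hc).contDiffAt (x := ‖x‖)).comp x hnorm
      exact (hF.div (hnorm.pow 2) (by simpa using hx)).smul rfPerpL.contDiff.contDiffAt
  · intro x
    by_cases hx : x = 0
    · subst hx
      have h0 : φ 0 = 0 := image_eq_zero_of_notMem_tsupport fun h => lt_irrefl (0:ℝ) (hsupp' h)
      rw [(rf_eventually_zero φ hsupp').fderiv_eq]
      simp [h0]
    · have hn : 0 < ‖x‖ := norm_pos_iff.mpr hx
      have hsq : ‖x‖ ^ 2 = x 0 ^ 2 + x 1 ^ 2 := by
        simp [EuclideanSpace.norm_sq_eq, Fin.sum_univ_two]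
      rw [rf_hasFDerivAt φ hc x hx, rf_hasFDerivAt φ hc x hx]
      generalize (∫ s in (0:ℝ)..‖x‖, s * φ s) = A
      generalize φ ‖x‖ = B
      generalize ‖x‖ = r at *
      have hx0 : x 0 ^ 2 = r ^ 2 - x 1 ^ 2 := by linarith
      simp [perp, EuclideanSpace.inner_single_right]
      constructor
      · ring
      · field_simp
        ring_nf
        rw [hx0]
        ring
end

section
/- Let R₀ > 0 and let φ : ℝ → ℝ be a continuous function with support contained in [0,R₀]. Then for every x ∈ ℝ² with x ≠ 0, one has (1/(2π)) ∫_{ℝ²} ((x−y)^⊥/|x−y|²) φ(|y|) dy = (x^⊥/|x|²) ∫₀^{|x|} s φ(s) ds. -/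
open MeasureTheory Real Classical

theorem bs_avg_inside (ξ : ℂ) (r : ℝ) (hr : 0 < r) (h : r < ‖ξ‖) :
    circleAverage (fun z => (ξ - z)⁻¹) 0 r = ξ⁻¹ := by
  have := DiffContOnCl.circleAverage (f := fun z : ℂ => (ξ - z)⁻¹) (c := 0) (R := r) ?_
  · simpa using this
  · apply DifferentiableOn.diffContOnCl
    intro z hz
    have hz' := Metric.closure_ball_subset_closedBall hz
    rw [mem_closedBall_zero_iff, abs_of_pos hr] at hz'
    have : ξ - z ≠ 0 := by
      intro h0
      rw [sub_eq_zero] at h0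
      rw [h0] at h
      linarith
    apply DifferentiableAt.differentiableWithinAt
    fun_prop (disch := assumption)

theorem bs_avg_outside (ξ : ℂ) (hξ : ξ ≠ 0) (r : ℝ) (h : ‖ξ‖ < r) :
    circleAverage (fun z => (ξ - z)⁻¹) 0 r = 0 := by
  have hr : 0 < r := (norm_nonneg _).trans_lt h
  rw [circleAverage_eq_circleIntegral hr.ne']
  have e : (∮ z in C(0, r), (z - 0)⁻¹ • (ξ - z)⁻¹)
      = ∮ z in C(0, r), ξ⁻¹ * ((z - 0)⁻¹ - (z - ξ)⁻¹) := by
    apply circleIntegral.integral_congr hr.le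
    intro z hz
    rw [mem_sphere_zero_iff_norm] at hz
    have hz0 : z ≠ 0 := by
      rintro rfl
      simp at hz
      linarith
    have h1 : ξ - z ≠ 0 := by
      intro h0
      rw [sub_eq_zero] at h0
      rw [h0] at h
      linarith
    have h2 : z - ξ ≠ 0 := by
      intro h0
      exact h1 (by linear_combination -h0)
    simp only [sub_zero, smul_eq_mul]
    field_simp
    ring
  have ci : ∀ w : ℂ, ‖w‖ < r → CircleIntegrable (fun z => (z - w)⁻¹) 0 r := by
    intro w hw
    apply ContinuousOn.circleIntegrable hr.le
    intro z hz
    rw [mem_sphere_zero_iff_norm] at hz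
    have h2 : z - w ≠ 0 := by
      intro h0
      rw [sub_eq_zero] at h0
      rw [h0] at hz
      linarith
    apply ContinuousAt.continuousWithinAt
    fun_prop (disch := assumption)
  rw [e, circleIntegral.integral_const_mul,
    circleIntegral.integral_sub (ci 0 (by simpa using hr)) (ci ξ h),
    circleIntegral.integral_sub_inv_of_mem_ball (by simpa using hr),
    circleIntegral.integral_sub_inv_of_mem_ball (by simpa using h)]
  simp

theorem bs_integral_theta (f : ℂ → ℂ) (r : ℝ) :
    ∫ θ in Set.Ioo (-π) π, f (Complex.polarCoord.symm (r, θ))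
      = (2 * π) • circleAverage f 0 r := by
  rw [← integral_Ioc_eq_integral_Ioo, ← intervalIntegral.integral_of_le (by linarith [pi_pos]),
    circleAverage_def, smul_smul, mul_inv_cancel₀ (by positivity), one_smul]
  have p : (fun θ => f (circleMap 0 r θ)).Periodic (2 * π) :=
    fun x => by simp [periodic_circleMap 0 r x]
  have := p.intervalIntegral_add_eq (-π) 0
  rw [zero_add, show -π + 2 * π = π by ring] at this
  rw [← this]
  congr 1
  ext θ
  simp [circleMap, Complex.exp_mul_I]

theorem bs_integrable (R₀ : ℝ) (φ : ℝ → ℝ)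
    (hφ : Continuous φ) (hsupp : Function.support φ ⊆ Set.Icc 0 R₀) (ξ : ℂ) :
    Integrable (fun w : ℂ => φ ‖w‖ • (ξ - w)⁻¹) := by
  obtain ⟨C, hC⟩ : ∃ C, ∀ s, ‖φ s‖ ≤ C := by
    have hc : HasCompactSupport φ :=
      HasCompactSupport.of_support_subset_isCompact isCompact_Icc hsupp
    exact hc.exists_bound_of_continuous hφ
  have hC0 : 0 ≤ C := (norm_nonneg _).trans (hC 0)
  set M : ℝ := ‖ξ‖ + R₀ + 1
  have h1 : Integrable (fun w : ℂ => (Metric.ball (0:ℂ) M).indicator (fun w => ‖w‖⁻¹) w) := by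
    rw [integrable_indicator_iff measurableSet_ball,
      integrableOn_fun_norm_addHaar (μ := (volume : Measure ℂ)) (f := fun s => s⁻¹),
      integrableOn_congr_fun (g := fun _ => (1:ℝ)) _ measurableSet_Ioo]
    · simp
    · intro y hy
      have : y ≠ 0 := hy.1.ne'
      simp [Complex.finrank_real_complex, this]
  have h2 := (h1.comp_sub_left ξ).const_mul C
  refine h2.mono' ?_ ?_
  · apply Measurable.aestronglyMeasurable
    have := hφ.measurable
    fun_prop
  · refine Filter.Eventually.of_forall fun w => ?_
    rw [norm_smul, norm_inv]
    by_cases hw : φ ‖w‖ = 0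
    · rw [hw]
      simp only [norm_zero, zero_mul]
      apply mul_nonneg hC0
      apply Set.indicator_nonneg
      intros
      positivity
    · have := (hsupp hw).2
      have hm : ξ - w ∈ Metric.ball (0:ℂ) M := by
        rw [mem_ball_zero_iff]
        have := norm_sub_le ξ w
        simp only [M]
        linarith
      rw [Set.indicator_of_mem hm]
      gcongr
      exact hC _

theorem bs_core (R₀ : ℝ) (φ : ℝ → ℝ)
    (hφ : Continuous φ) (hsupp : Function.support φ ⊆ Set.Icc 0 R₀) (ξ : ℂ) (hξ : ξ ≠ 0) :
    ∫ w : ℂ, φ ‖w‖ • (ξ - w)⁻¹ = (2 * π * ∫ s in (0:ℝ)..‖ξ‖, s * φ s) • ξ⁻¹ := by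
  have hi := bs_integrable R₀ φ hφ hsupp ξ
  rw [← Complex.integral_comp_polarCoord_symm, polarCoord_target]
  have hint : IntegrableOn (fun p : ℝ × ℝ => p.1 • (fun w : ℂ => φ ‖w‖ • (ξ - w)⁻¹)
      (Complex.polarCoord.symm p)) (Set.Ioi 0 ×ˢ Set.Ioo (-π) π) := by
    refine ⟨?_, ?_⟩
    · apply Measurable.aestronglyMeasurable
      have := hφ.measurable
      simp only [Complex.polarCoord_symm_apply]
      fun_prop
    · have h2 := hi.2
      rw [hasFiniteIntegral_iff_enorm] at h2 ⊢
      rw [← Complex.lintegral_comp_polarCoord_symm, polarCoord_target] at h2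
      refine lt_of_eq_of_lt ?_ h2
      apply setLIntegral_congr_fun (measurableSet_Ioi.prod measurableSet_Ioo)
      intro p hp
      have hp1 : 0 < p.1 := hp.1
      simp only [enorm_smul, smul_eq_mul]
      rw [Real.enorm_of_nonneg hp1.le]
  rw [Measure.volume_eq_prod] at hint ⊢
  rw [setIntegral_prod _ hint]
  have step : ∀ r ∈ Set.Ioi (0:ℝ), r ≠ ‖ξ‖ →
      (∫ θ in Set.Ioo (-π) π, r • (φ ‖Complex.polarCoord.symm (r, θ)‖ •
        (ξ - Complex.polarCoord.symm (r, θ))⁻¹))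
      = (Set.Ioc 0 ‖ξ‖).indicator (fun r => (2 * π * (r * φ r)) • ξ⁻¹) r := by
    intro r hr hne
    have hr' : 0 < r := hr
    simp only [Complex.norm_polarCoord_symm, abs_of_pos hr', integral_smul]
    rw [bs_integral_theta (fun z => (ξ - z)⁻¹)]
    rcases lt_or_gt_of_ne hne with h | h
    · rw [bs_avg_inside ξ r hr h, Set.indicator_of_mem (Set.mem_Ioc.2 ⟨hr', h.le⟩)]
      simp only [smul_smul]
      congr 1
      ring
    · rw [bs_avg_outside ξ hξ r h, Set.indicator_of_notMem (fun hh => absurd hh.2 (not_le.2 h))]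
      simp
  have hae : ∀ᵐ r : ℝ, r ≠ ‖ξ‖ := by simp [ae_iff, measure_singleton]
  rw [setIntegral_congr_ae (g := (Set.Ioc 0 ‖ξ‖).indicator
    (fun r => (2 * π * (r * φ r)) • ξ⁻¹)) measurableSet_Ioi
    (hae.mono fun r h hr => step r hr h)]
  rw [setIntegral_indicator measurableSet_Ioc,
    Set.inter_eq_right.2 Set.Ioc_subset_Ioi_self, integral_smul_const, integral_const_mul,
    intervalIntegral.integral_of_le (norm_nonneg _)]

theorem bs_perp (z : ℂ) : perp (Complex.orthonormalBasisOneI.repr z)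
    = Complex.orthonormalBasisOneI.repr (Complex.I * z) := by
  ext i
  fin_cases i <;> simp [perp]

theorem biotSavart_radial (R₀ : ℝ) (hR₀ : 0 < R₀) (φ : ℝ → ℝ)
    (hφ : Continuous φ)
    (hsupp : Function.support φ ⊆ Set.Icc 0 R₀) :
    ∀ x : EuclideanSpace ℝ (Fin 2), x ≠ 0 →
      (1 / (2 * π)) • (∫ y : EuclideanSpace ℝ (Fin 2),
          (φ ‖y‖ / ‖x - y‖ ^ 2) • perp (x - y)) =
        ((∫ s in (0:ℝ)..‖x‖, s * φ s) / ‖x‖ ^ 2) • perp x := by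
  intro x hx
  obtain ⟨ξ, rfl⟩ := Complex.orthonormalBasisOneI.repr.surjective x
  have hξ : ξ ≠ 0 := by
    rintro rfl
    simp at hx
  set L := Complex.orthonormalBasisOneI.repr with hL
  let M : ℂ →L[ℝ] EuclideanSpace ℝ (Fin 2) :=
    (L.toContinuousLinearEquiv : ℂ →L[ℝ] EuclideanSpace ℝ (Fin 2)) ∘L
      ((ContinuousLinearMap.mul ℝ ℂ Complex.I) ∘L (Complex.conjCLE : ℂ →L[ℝ] ℂ))
  have hM : ∀ u, M u = L (Complex.I * (starRingEnd ℂ) u) := fun u => rfl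
  have key : ∀ (a : ℝ) (z : ℂ), (a / ‖z‖ ^ 2) • perp (L z) = M (a • z⁻¹) := by
    intro a z
    rw [bs_perp, hM, ← map_smul]
    congr 1
    rw [Complex.inv_def]
    simp only [Complex.real_smul, map_mul, Complex.conj_conj, Complex.conj_ofReal,
      Complex.normSq_eq_norm_sq]
    push_cast
    ring
  rw [← L.measurePreserving.integral_comp L.toHomeomorph.measurableEmbedding]
  simp only [← map_sub, LinearIsometryEquiv.norm_map, key]
  rw [M.integral_comp_comm (bs_integrable R₀ φ hφ hsupp ξ), bs_core R₀ φ hφ hsupp ξ hξ,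
    ← map_smul, smul_smul]
  congr 2
  field_simp
end

section
/- Let R₀ > 0 and let ω : ℝ³ → ℝ³ be a continuous vector field with support contained in the closed ball B(0,R₀). Define u : ℝ³ → ℝ³ by u(x) = −(1/(4π)) ∫_{ℝ³} ((x−y)/|x−y|³) × ω(y) dy. Then u is differentiable at every x ∈ ℝ³ with |x| ≥ 2R₀, and there exists an absolute constant C > 0 such that for every such x the Fréchet derivative satisfies ‖Du(x)‖ ≤ C ‖ω‖_{L¹(ℝ³)} / |x|³. -/
open MeasureTheory Real

/-- The cross product of two vectors in `ℝ³` (as `EuclideanSpace`). -/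
noncomputable def cross3 (a b : EuclideanSpace ℝ (Fin 3)) : EuclideanSpace ℝ (Fin 3) :=
  (EuclideanSpace.equiv (Fin 3) ℝ).symm
    ![a 1 * b 2 - a 2 * b 1, a 2 * b 0 - a 0 * b 2, a 0 * b 1 - a 1 * b 0]

/-- The three-dimensional Biot–Savart law
`u(x) = −(1/(4π)) ∫ ((x−y)/|x−y|³) × ω(y) dy`. -/
noncomputable def biotSavart3D (ω : EuclideanSpace ℝ (Fin 3) → EuclideanSpace ℝ (Fin 3))
    (x : EuclideanSpace ℝ (Fin 3)) : EuclideanSpace ℝ (Fin 3) :=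
  -(1 / (4 * π)) • ∫ y, cross3 ((1 / ‖x - y‖ ^ 3) • (x - y)) (ω y)

abbrev E3 := EuclideanSpace ℝ (Fin 3)

noncomputable def crossB : E3 →L[ℝ] E3 →L[ℝ] E3 :=
  LinearMap.toContinuousLinearMap
    ((LinearMap.toContinuousLinearMap : (E3 →ₗ[ℝ] E3) ≃ₗ[ℝ] (E3 →L[ℝ] E3)).toLinearMap ∘ₗ
      (LinearMap.mk₂ ℝ cross3
        (by intro a a' b; ext i; fin_cases i <;> simp [cross3] <;> ring)
        (by intro c a b; ext i; fin_cases i <;> simp [cross3] <;> ring)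
        (by intro a b b'; ext i; fin_cases i <;> simp [cross3] <;> ring)
        (by intro c a b; ext i; fin_cases i <;> simp [cross3] <;> ring)))

lemma crossB_apply (a b : E3) : crossB a b = cross3 a b := rfl

noncomputable def KK (z : E3) : E3 := (1 / ‖z‖ ^ 3) • z

lemma KK_deriv (z : E3) (hz : z ≠ 0) :
    DifferentiableAt ℝ KK z ∧ ‖fderiv ℝ KK z‖ ≤ 4 / ‖z‖ ^ 3 := by
  have hzp : 0 < ‖z‖ := norm_pos_iff.2 hz
  have hd : DifferentiableAt ℝ (fun z : E3 => ‖z‖) z := (contDiffAt_norm ℝ hz (n := 1)).differentiableAt (by norm_num)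
  have hN := hd.hasFDerivAt
  have hN1 : ‖fderiv ℝ (fun z : E3 => ‖z‖) z‖ ≤ 1 := (norm_fderiv_norm hd).le
  set N := fderiv ℝ (fun z : E3 => ‖z‖) z
  have h1 : HasFDerivAt (fun z : E3 => 1 / ‖z‖ ^ 3) ((-3 / ‖z‖ ^ 4) • N) z := by
    have hh : HasDerivAt (fun t : ℝ => 1 / t ^ 3) (-3 / ‖z‖ ^ 4) ‖z‖ := by
      have h := ((hasDerivAt_pow 3 ‖z‖).inv (by positivity))
      have e1 : (fun t : ℝ => 1 / t ^ 3) = (fun x : ℝ => x ^ 3)⁻¹ := by ext t; simp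
      rw [e1]
      refine h.congr_deriv ?_
      push_cast
      field_simp
      try norm_num
    exact hh.comp_hasFDerivAt z hN
  have h2 : HasFDerivAt KK _ z := h1.smul (hasFDerivAt_id z)
  refine ⟨h2.differentiableAt, ?_⟩
  rw [h2.fderiv]
  refine (norm_add_le _ _).trans ?_
  have e1 : ‖(1 / ‖z‖ ^ 3) • ContinuousLinearMap.id ℝ E3‖ ≤ 1 / ‖z‖ ^ 3 := by
    rw [norm_smul, Real.norm_of_nonneg (by positivity)]
    exact mul_le_of_le_one_right (by positivity) ContinuousLinearMap.norm_id_le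
  have e2 : ‖((-3 / ‖z‖ ^ 4) • N).smulRight z‖ ≤ 3 / ‖z‖ ^ 3 := by
    rw [ContinuousLinearMap.norm_smulRight_apply, norm_smul, norm_div, norm_neg, norm_pow, norm_norm]
    calc _ ≤ ‖(3:ℝ)‖ / ‖z‖ ^ 4 * 1 * ‖z‖ := by gcongr
      _ = _ := by rw [Real.norm_of_nonneg (by norm_num)]; field_simp
  calc _ ≤ 1 / ‖z‖ ^ 3 + 3 / ‖z‖ ^ 3 := add_le_add e1 e2
    _ = _ := by ring

lemma final_aux {p q c I n : ℝ} (hp : p ≤ 1) (hq : q ≤ (256 * c / n ^ 3) * I) (hq0 : 0 ≤ q)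
    (hI : 0 ≤ I) (hn : 0 < n) : p * q ≤ (256 * c + 1) * I / n ^ 3 := by
  have h1 : p * q ≤ 1 * q := mul_le_mul_of_nonneg_right hp hq0
  have h2 : (256 * c + 1) * I / n ^ 3 = (256 * c / n ^ 3) * I + I / n ^ 3 := by ring
  have h3 : 0 ≤ I / n ^ 3 := by positivity
  linarith

set_option maxHeartbeats 1000000 in
theorem biotSavart3D_grad_decay :
    ∃ C > 0, ∀ R₀ : ℝ, 0 < R₀ →
      ∀ ω : EuclideanSpace ℝ (Fin 3) → EuclideanSpace ℝ (Fin 3),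
      Continuous ω →
      Function.support ω ⊆ Metric.closedBall 0 R₀ →
      ∀ x : EuclideanSpace ℝ (Fin 3), 2 * R₀ ≤ ‖x‖ →
        DifferentiableAt ℝ (biotSavart3D ω) x ∧
        ‖fderiv ℝ (biotSavart3D ω) x‖ ≤ C * (∫ y, ‖ω y‖) / ‖x‖ ^ 3 := by
  refine ⟨256 * ‖crossB‖ + 1, by positivity, ?_⟩
  intro R₀ hR ω hω hsupp x₀ hx₀
  have hx0 : 0 < ‖x₀‖ := by linarith
  have hcs : HasCompactSupport ω :=
    HasCompactSupport.of_support_subset_isCompact (isCompact_closedBall 0 R₀) hsupp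
  have hint : Integrable ω := hω.integrable_of_hasCompactSupport hcs
  have hdist : ∀ y, ω y ≠ 0 → ∀ x ∈ Metric.ball x₀ (‖x₀‖ / 4), ‖x₀‖ / 4 ≤ ‖x - y‖ := by
    intro y hy x hx
    have hy' : ‖y‖ ≤ R₀ := by simpa using hsupp hy
    have hx' : ‖x - x₀‖ < ‖x₀‖ / 4 := by simpa [dist_eq_norm] using hx
    have : ‖x₀‖ ≤ ‖x - y‖ + ‖y‖ + ‖x - x₀‖ := by
      calc ‖x₀‖ = ‖(x - y) + y - (x - x₀)‖ := by congr 1; abel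
        _ ≤ _ := (norm_sub_le _ _).trans (by gcongr; exact norm_add_le _ _)
    linarith
  have hKm : Measurable KK := by
    unfold KK
    fun_prop
  let F : E3 → E3 → E3 := fun x y => crossB (KK (x - y)) (ω y)
  let F' : E3 → E3 → (E3 →L[ℝ] E3) := fun x y => (crossB.flip (ω y)).comp (fderiv ℝ KK (x - y))
  let bound : E3 → ℝ := fun y => (256 * ‖crossB‖ / ‖x₀‖ ^ 3) * ‖ω y‖
  have hFm : ∀ x, AEStronglyMeasurable (F x) volume := by
    intro x
    have a : Measurable fun y => KK (x - y) := hKm.comp (by fun_prop)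
    have c : Continuous fun p : E3 × E3 => crossB p.1 p.2 := by fun_prop
    exact (c.measurable.comp (a.prodMk hω.measurable)).aestronglyMeasurable
  have hFd : ∀ y, ∀ x ∈ Metric.ball x₀ (‖x₀‖ / 4), HasFDerivAt (F · y) (F' x y) x := by
    intro y x hx
    by_cases hy : ω y = 0
    · have e1 : (F · y) = fun _ => 0 := by ext1 x; simp [F, hy]
      have e2 : F' x y = 0 := by simp [F', hy]
      rw [e1, e2]; exact hasFDerivAt_const _ _
    · have hne : x - y ≠ 0 := norm_pos_iff.1 (by linarith [hdist y hy x hx])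
      have h1 := (KK_deriv _ hne).1.hasFDerivAt
      have h2 : HasFDerivAt (fun x => KK (x - y)) (fderiv ℝ KK (x - y)) x := by
        have h3 := h1.comp x ((hasFDerivAt_id x).sub_const y)
        rw [ContinuousLinearMap.comp_id] at h3
        exact h3
      exact (crossB.flip (ω y)).hasFDerivAt.comp x h2
  have hb : ∀ y, ∀ x ∈ Metric.ball x₀ (‖x₀‖ / 4), ‖F' x y‖ ≤ bound y := by
    intro y x hx
    by_cases hy : ω y = 0
    · simp [F', bound, hy]
    · have hd := hdist y hy x hx
      have hne : x - y ≠ 0 := norm_pos_iff.1 (by linarith)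
      have h1 := (KK_deriv _ hne).2
      calc ‖F' x y‖ ≤ ‖crossB.flip (ω y)‖ * ‖fderiv ℝ KK (x - y)‖ :=
            ContinuousLinearMap.opNorm_comp_le _ _
        _ ≤ (‖crossB‖ * ‖ω y‖) * (4 / (‖x₀‖ / 4) ^ 3) := by
            gcongr
            · simpa using crossB.flip.le_opNorm (ω y)
            · exact h1.trans (by gcongr)
        _ = bound y := by simp only [bound]; field_simp; norm_num
  have hbi : Integrable bound := hint.norm.const_mul _
  have hmem : x₀ ∈ Metric.ball x₀ (‖x₀‖ / 4) := Metric.mem_ball_self (by positivity)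
  have hFi : Integrable (F x₀) := by
    refine (hint.norm.const_mul (‖crossB‖ * (1 / (‖x₀‖ / 4) ^ 2))).mono' (hFm x₀) ?_
    refine Filter.Eventually.of_forall fun y => ?_
    by_cases hy : ω y = 0
    · simp [F, hy]
    · have hd := hdist y hy x₀ hmem
      have hp : 0 < ‖x₀ - y‖ := by linarith
      refine (crossB.le_opNorm₂ _ _).trans ?_
      gcongr
      have : ‖KK (x₀ - y)‖ = 1 / ‖x₀ - y‖ ^ 2 := by
        rw [KK, norm_smul, Real.norm_of_nonneg (by positivity)]; field_simp
      rw [this]; gcongr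
  have hF'm : AEStronglyMeasurable (F' x₀) volume := by
    have a : Measurable fun y => fderiv ℝ KK (x₀ - y) :=
      (measurable_fderiv ℝ KK).comp (by fun_prop)
    have b : Measurable fun y => crossB.flip (ω y) := (crossB.flip.continuous.comp hω).measurable
    have c : Continuous fun p : (E3 →L[ℝ] E3) × (E3 →L[ℝ] E3) => p.1.comp p.2 := by fun_prop
    exact (c.measurable.comp (b.prodMk a)).aestronglyMeasurable
  have key := hasFDerivAt_integral_of_dominated_of_fderiv_le (𝕜 := ℝ) (μ := volume) (F := F) (F' := F')
    (Metric.ball_mem_nhds x₀ (by positivity : 0 < ‖x₀‖ / 4)) (Filter.Eventually.of_forall hFm) hFi hF'm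
    (Filter.Eventually.of_forall hb) hbi (Filter.Eventually.of_forall hFd)
  have key2 : HasFDerivAt (biotSavart3D ω) (-(1 / (4 * π)) • ∫ y, F' x₀ y) x₀ :=
    key.const_smul (-(1 / (4 * π)))
  refine ⟨key2.differentiableAt, ?_⟩
  rw [key2.fderiv, norm_smul]
  have hI : ‖∫ y, F' x₀ y‖ ≤ (256 * ‖crossB‖ / ‖x₀‖ ^ 3) * ∫ y, ‖ω y‖ := by
    rw [← integral_const_mul]
    exact norm_integral_le_of_norm_le hbi (Filter.Eventually.of_forall fun y => hb y x₀ hmem)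
  have hpi : ‖-(1 / (4 * π))‖ ≤ 1 := by
    rw [norm_neg, Real.norm_of_nonneg (by positivity), div_le_one (by positivity)]
    linarith [Real.pi_gt_three]
  have h0 : 0 ≤ ∫ y, ‖ω y‖ := integral_nonneg fun _ => norm_nonneg _
  exact final_aux hpi hI (norm_nonneg _) h0 hx0
end

section
/- Let ω : ℝ³ → ℝ³ be a continuously differentiable, compactly supported vector field with div ω = 0 (that is, ∂₁ω¹ + ∂₂ω² + ∂₃ω³ = 0 everywhere). Define the vector-valued stream function Ψ : ℝ³ → ℝ³ componentwise by Ψ(x) = (1/(4π)) ∫_{ℝ³} ω(y)/|x−y| dy. Then Ψ is continuously differentiable and div Ψ(x) = 0 for every x ∈ ℝ³. -/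
open MeasureTheory Real

/-- The componentwise Newtonian potential (vector-valued stream function)
`Ψ(x) = (1/(4π)) ∫ ω(y)/|x−y| dy` of a vector field `ω` on `ℝ³`. -/
noncomputable def vectorStream (ω : EuclideanSpace ℝ (Fin 3) → EuclideanSpace ℝ (Fin 3))
    (x : EuclideanSpace ℝ (Fin 3)) : EuclideanSpace ℝ (Fin 3) :=
  (1 / (4 * π)) • ∫ y, (1 / ‖x - y‖) • ω y

open scoped Convolution in
theorem aux_locInt : LocallyIntegrable (fun t : EuclideanSpace ℝ (Fin 3) => 1 / ‖t‖) := by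
  refine locallyIntegrable_of_norm_le_rpow (C := 1) (α := 1) (by simp) ?_ ?_ ?_
  · simp
  · refine Filter.Eventually.of_forall fun x => ?_
    rw [Real.rpow_neg_one]
    simp
  · exact (measurable_const.div measurable_norm).aestronglyMeasurable

open scoped Convolution in
theorem vectorStream_divFree
    (ω : EuclideanSpace ℝ (Fin 3) → EuclideanSpace ℝ (Fin 3))
    (hω : ContDiff ℝ 1 ω)
    (hsupp : HasCompactSupport ω)
    (hdiv : ∀ x, ∑ i : Fin 3, fderiv ℝ ω x (EuclideanSpace.single i 1) i = 0) :
    ContDiff ℝ 1 (vectorStream ω) ∧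
    ∀ x, ∑ i : Fin 3, fderiv ℝ (vectorStream ω) x (EuclideanSpace.single i 1) i = 0 := by
  have hf := aux_locInt
  set f := fun t : EuclideanSpace ℝ (Fin 3) => 1 / ‖t‖ with hfdef
  let L := ContinuousLinearMap.lsmul ℝ ℝ (E := EuclideanSpace ℝ (Fin 3))
  have heq : vectorStream ω = (1 / (4 * π)) • (f ⋆[L, volume] ω) := by
    funext x
    rw [Pi.smul_apply, convolution_eq_swap]
    rfl
  have hc : Continuous (fderiv ℝ ω) := hω.continuous_fderiv one_ne_zero
  have hs : HasCompactSupport (fderiv ℝ ω) := hsupp.fderiv ℝ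
  rw [heq]
  have hcd : ContDiff ℝ 1 (f ⋆[L, volume] ω) := by
    have := hsupp.contDiff_convolution_right (n := 1) (μ := volume) L hf (by exact_mod_cast hω)
    exact_mod_cast this
  refine ⟨contDiff_const.smul hcd, fun x => ?_⟩
  rw [((hsupp.hasFDerivAt_convolution_right L hf hω x).const_smul (1 / (4 * π))).fderiv]
  have key : ∀ i : Fin 3, Integrable (fun t => f t • fderiv ℝ ω (x - t) (EuclideanSpace.single i 1)) := by
    intro i
    have := (hs.comp_left (g := fun A : EuclideanSpace ℝ (Fin 3) →L[ℝ] EuclideanSpace ℝ (Fin 3) =>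
      A (EuclideanSpace.single i 1)) (by simp)).convolutionExists_right L hf
      (hc.clm_apply continuous_const) x
    exact this
  have h2 : ∀ i : Fin 3, ((f ⋆[L.precompR _, volume] fderiv ℝ ω) x) (EuclideanSpace.single i 1) i
      = ∫ t, f t * (fderiv ℝ ω (x - t) (EuclideanSpace.single i 1) i) := by
    intro i
    rw [convolution_precompR_apply L hf hs hc]
    exact ((EuclideanSpace.proj (𝕜 := ℝ) i).integral_comp_comm (key i)).symm
  simp only [ContinuousLinearMap.smul_apply, PiLp.smul_apply, h2]
  rw [← Finset.smul_sum, ← integral_finset_sum]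
  · simp only [← Finset.mul_sum, hdiv, mul_zero, integral_zero, smul_zero]
  · intro i _
    exact (EuclideanSpace.proj (𝕜 := ℝ) i).integrable_comp (key i)
end

section
/- Let R₀ > 0, θ ∈ [0,1], δ₁ ∈ (0,1/2], and let g : ℝ → ℝ be a smooth function with 0 ≤ g ≤ 1, g(t) = 0 for t ≤ 0, and g(t) = 1 for t ≥ δ₁/2. For R > 0 define φ^R : ℝ² → ℝ by φ^R(x) = g(R^{−θ}(R − |x|)). Let ω : ℝ² → ℝ be continuously differentiable with support contained in B(0,R₀), set m = ∫_{ℝ²} ω, let u(x) = (1/(2π)) ∫_{ℝ²} ((x−y)^⊥/|x−y|²) ω(y) dy, let ψ_R(x) = (1/(2π)) ∫_{ℝ²} log|x−y| ω(y) dy − (m/(2π)) log R, and let T_R u = ∇^⊥(φ^R ψ_R). Then there exists a constant C > 0, depending only on R₀, θ, δ₁ and g, such that for every R ≥ max(4R₀, 1): ‖D(u − T_R u)‖_{L²(B(0,R))} ≤ C ( ‖ω‖_{L¹(ℝ²)} R^{−(1+3θ)/2} + |m| R^{−(1+θ)/2} ), where D denotes the (Fréchet) derivative. -/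
open MeasureTheory Real

/-- The perpendicular gradient `∇^⊥ f = (−∂₂f, ∂₁f)` of a scalar function on `ℝ²`. -/
noncomputable def perpGrad (f : EuclideanSpace ℝ (Fin 2) → ℝ)
    (x : EuclideanSpace ℝ (Fin 2)) : EuclideanSpace ℝ (Fin 2) :=
  (EuclideanSpace.equiv (Fin 2) ℝ).symm
    ![-(fderiv ℝ f x (EuclideanSpace.single 1 1)),
      fderiv ℝ f x (EuclideanSpace.single 0 1)]

/-- The stream function of `ω` normalized so that it vanishes at `|x| = R`
when `ω` is radial: `ψ_R(x) = (1/(2π)) ∫ log|x−y| ω(y) dy − (m/(2π)) log R`. -/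
noncomputable def streamR (ω : EuclideanSpace ℝ (Fin 2) → ℝ) (m R : ℝ)
    (x : EuclideanSpace ℝ (Fin 2)) : ℝ :=
  (1 / (2 * π)) * (∫ y, Real.log ‖x - y‖ * ω y) - (m / (2 * π)) * Real.log R

/-- The boundary-layer cutoff `φ^R(x) = g(R^{−θ}(R − |x|))`. -/
noncomputable def cutoff (g : ℝ → ℝ) (θ R : ℝ) (x : EuclideanSpace ℝ (Fin 2)) : ℝ :=
  g (R ^ (-θ) * (R - ‖x‖))

/-- The truncation operator `T_R u = ∇^⊥(φ^R ψ_R)`. -/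
noncomputable def truncate (g : ℝ → ℝ) (θ R : ℝ) (ω : EuclideanSpace ℝ (Fin 2) → ℝ)
    (m : ℝ) : EuclideanSpace ℝ (Fin 2) → EuclideanSpace ℝ (Fin 2) :=
  perpGrad (fun x => cutoff g θ R x * streamR ω m R x)


noncomputable def GG (z : E2) : E2 := (‖z‖ ^ 2)⁻¹ • z

noncomputable def DGc (w : E2) : E2 →L[ℝ] E2 :=
  (‖w‖ ^ 2) • ContinuousLinearMap.id ℝ E2 - (2 : ℝ) • (innerSL ℝ w).smulRight w

lemma norm_GG (z : E2) : ‖GG z‖ = ‖z‖⁻¹ := by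
  unfold GG
  rw [norm_smul, norm_inv, norm_pow, norm_norm]
  by_cases h : ‖z‖ = 0
  · simp [h]
  · field_simp

lemma GG_sub {a b : E2} (ha : a ≠ 0) (hb : b ≠ 0) :
    ‖GG a - GG b‖ = ‖a - b‖ / (‖a‖ * ‖b‖) := by
  have := EuclideanGeometry.dist_inversion_inversion (c := (0 : E2)) ha hb 1
  simp only [EuclideanGeometry.inversion, vsub_eq_sub, sub_zero, vadd_eq_add, add_zero,
    dist_eq_norm, one_pow, one_div] at this
  unfold GG
  rw [← inv_pow, ← inv_pow, this]
  ring

lemma norm_DGc_le (w : E2) : ‖DGc w‖ ≤ 3 * ‖w‖ ^ 2 := by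
  unfold DGc
  refine (norm_sub_le _ _).trans ?_
  have h1 : ‖(‖w‖ ^ 2) • ContinuousLinearMap.id ℝ E2‖ ≤ ‖w‖ ^ 2 := by
    rw [norm_smul, norm_pow, norm_norm]
    exact mul_le_of_le_one_right (by positivity) ContinuousLinearMap.norm_id_le
  have h2 : ‖(2 : ℝ) • (innerSL ℝ w).smulRight w‖ ≤ 2 * ‖w‖ ^ 2 := by
    rw [norm_smul, ContinuousLinearMap.norm_smulRight_apply, innerSL_apply_norm]
    simp [sq]
  linarith

lemma norm_DGc_sub_le (w v : E2) : ‖DGc w - DGc v‖ ≤ 3 * (‖w‖ + ‖v‖) * ‖w - v‖ := by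
  have e : DGc w - DGc v = (‖w‖ ^ 2 - ‖v‖ ^ 2) • ContinuousLinearMap.id ℝ E2
      - (2 : ℝ) • ((innerSL ℝ w).smulRight (w - v) + (innerSL ℝ (w - v)).smulRight v) := by
    ext1 x
    simp only [DGc, sub_apply, smul_apply,
      add_apply, ContinuousLinearMap.smulRight_apply, innerSL_apply_apply,
      ContinuousLinearMap.id_apply, inner_sub_left]
    module
  rw [e]
  refine (norm_sub_le _ _).trans ?_
  have h1 : ‖(‖w‖ ^ 2 - ‖v‖ ^ 2) • ContinuousLinearMap.id ℝ E2‖ ≤ (‖w‖ + ‖v‖) * ‖w - v‖ := by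
    rw [norm_smul]
    refine (mul_le_of_le_one_right (by positivity) ContinuousLinearMap.norm_id_le).trans ?_
    rw [sq_sub_sq, norm_mul, Real.norm_eq_abs, Real.norm_eq_abs, abs_of_nonneg (by positivity)]
    exact mul_le_mul_of_nonneg_left (abs_norm_sub_norm_le _ _) (by positivity)
  have h2 : ‖(2 : ℝ) • ((innerSL ℝ w).smulRight (w - v) + (innerSL ℝ (w - v)).smulRight v)‖
      ≤ 2 * ((‖w‖ + ‖v‖) * ‖w - v‖) := by
    rw [norm_smul, Real.norm_two]
    refine mul_le_mul_of_nonneg_left ((norm_add_le _ _).trans ?_) (by norm_num)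
    rw [ContinuousLinearMap.norm_smulRight_apply, ContinuousLinearMap.norm_smulRight_apply,
      innerSL_apply_norm, innerSL_apply_norm]
    linarith
  linarith

lemma hasFDerivAt_GG {z : E2} (hz : z ≠ 0) : HasFDerivAt GG (DGc (GG z)) z := by
  have h0 : ‖z‖ ≠ 0 := norm_ne_zero_iff.mpr hz
  have h1 := (hasStrictFDerivAt_norm_sq z).hasFDerivAt
  have h2 := (hasDerivAt_inv (pow_ne_zero 2 h0)).comp_hasFDerivAt z h1
  have h3 := h2.smul (hasFDerivAt_id z)
  refine h3.congr_fderiv ?_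
  ext1 x
  simp only [DGc, norm_GG]
  simp [GG, smul_smul]
  module

/-- unit vector field -/
noncomputable def nn (z : E2) : E2 := ‖z‖⁻¹ • z

lemma norm_nn {z : E2} (hz : z ≠ 0) : ‖nn z‖ = 1 := by
  unfold nn
  rw [norm_smul, norm_inv, norm_norm]
  exact inv_mul_cancel₀ (norm_ne_zero_iff.mpr hz)

lemma hasFDerivAt_norm' {z : E2} (hz : z ≠ 0) :
    HasFDerivAt (fun x : E2 => ‖x‖) (innerSL ℝ (nn z)) z := by
  have h0 : ‖z‖ ≠ 0 := norm_ne_zero_iff.mpr hz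
  have h1 := (hasStrictFDerivAt_norm_sq z).hasFDerivAt
  have h2 := (Real.hasDerivAt_sqrt (pow_ne_zero 2 h0)).comp_hasFDerivAt z h1
  have : (fun x : E2 => ‖x‖) = Real.sqrt ∘ (fun x : E2 => ‖x‖ ^ 2) := by
    ext x; simp
  rw [this]
  refine h2.congr_fderiv ?_
  ext1 x
  simp [nn]
  field_simp

noncomputable def Dnn (z : E2) : E2 →L[ℝ] E2 :=
  ‖z‖⁻¹ • ContinuousLinearMap.id ℝ E2 + ((-(‖z‖ ^ 2)⁻¹) • (innerSL ℝ (nn z))).smulRight z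

lemma hasFDerivAt_nn {z : E2} (hz : z ≠ 0) : HasFDerivAt nn (Dnn z) z := by
  have h0 : ‖z‖ ≠ 0 := norm_ne_zero_iff.mpr hz
  have h2 := (hasDerivAt_inv h0).comp_hasFDerivAt z (hasFDerivAt_norm' hz)
  exact h2.smul (hasFDerivAt_id z)

lemma norm_Dnn_le {z : E2} (hz : z ≠ 0) : ‖Dnn z‖ ≤ 2 * ‖z‖⁻¹ := by
  have h0 : ‖z‖ ≠ 0 := norm_ne_zero_iff.mpr hz
  unfold Dnn
  refine (norm_add_le _ _).trans ?_
  have h1 : ‖‖z‖⁻¹ • ContinuousLinearMap.id ℝ E2‖ ≤ ‖z‖⁻¹ := by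
    rw [norm_smul, norm_inv, norm_norm]
    exact mul_le_of_le_one_right (by positivity) ContinuousLinearMap.norm_id_le
  have h2 : ‖((-(‖z‖ ^ 2)⁻¹) • (innerSL ℝ (nn z))).smulRight z‖ = ‖z‖⁻¹ := by
    rw [ContinuousLinearMap.norm_smulRight_apply, norm_smul, innerSL_apply_norm, norm_nn hz,
      norm_neg, norm_inv, norm_pow, norm_norm]
    field_simp
  linarith

lemma perpGrad_eq {f : E2 → ℝ} {x v : E2} (h : HasFDerivAt f (innerSL ℝ v) x) :
    perpGrad f x = perpL v := by
  unfold perpGrad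
  rw [h.fderiv, perpL_apply]
  unfold perp
  congr 1
  ext i
  fin_cases i <;> simp [EuclideanSpace.inner_single_right]

noncomputable def kap (z : E2) : ℝ := ((√‖z‖) ^ 3)⁻¹

lemma kap_nonneg (z : E2) : 0 ≤ kap z := by unfold kap; positivity

lemma measurable_kap : Measurable kap := by unfold kap; fun_prop

lemma kap_integrable : Integrable ((Metric.ball (0 : E2) 1).indicator kap) := by
  have h := (integrable_fun_norm_addHaar (volume : Measure E2)
    (f := (Set.Iio (1 : ℝ)).indicator (fun r => ((√r) ^ 3)⁻¹))).mpr ?_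
  · refine h.congr (Filter.Eventually.of_forall fun z => ?_)
    simp [Set.indicator, kap]
  · simp only [finrank_euclideanSpace, Fintype.card_fin]
    have h1 : IntegrableOn (fun r : ℝ => r ^ (-(1 / 2) : ℝ)) (Set.Ioo 0 1) :=
      (intervalIntegral.integrableOn_Ioo_rpow_iff one_pos).mpr (by norm_num)
    have h2 : IntegrableOn ((Set.Ioo (0 : ℝ) 1).indicator (fun r : ℝ => r ^ (-(1 / 2) : ℝ)))
        (Set.Ioi 0) :=
      ((integrable_indicator_iff measurableSet_Ioo).mpr h1).integrableOn
    refine h2.congr_fun (fun r hr => ?_) measurableSet_Ioi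
    have hr' : 0 < r := hr
    by_cases h3 : r < 1
    · simp only [Set.indicator, Set.mem_Ioo, Set.mem_Iio, hr', h3, and_self, if_true]
      rw [Real.rpow_neg hr'.le, ← Real.sqrt_eq_rpow]
      have : √r ≠ 0 := (Real.sqrt_pos.mpr hr').ne'
      have e : r = √r ^ 2 := (Real.sq_sqrt hr'.le).symm
      simp only [smul_eq_mul]
      norm_num
      nth_rewrite 2 [e]
      field_simp
    · simp [Set.indicator, h3]

lemma kap_le_one {z : E2} (hz : 1 ≤ ‖z‖) : kap z ≤ 1 := by
  unfold kap
  have : 1 ≤ √‖z‖ := Real.one_le_sqrt.mpr hz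
  exact inv_le_one_of_one_le₀ (one_le_pow₀ this)

lemma inv_norm_le_kap (z : E2) : ‖z‖⁻¹ ≤ kap z + 1 := by
  unfold kap
  by_cases h : ‖z‖ = 0
  · simp [h]
  have hp : 0 < ‖z‖ := lt_of_le_of_ne (norm_nonneg _) (Ne.symm h)
  have hs : 0 < √‖z‖ := Real.sqrt_pos.mpr hp
  have e : ‖z‖ = √‖z‖ ^ 2 := (Real.sq_sqrt hp.le).symm
  nth_rewrite 1 [e]
  by_cases h1 : √‖z‖ ≤ 1
  · have : (√‖z‖ ^ 2)⁻¹ ≤ (√‖z‖ ^ 3)⁻¹ :=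
      inv_anti₀ (by positivity) (pow_le_pow_of_le_one hs.le h1 (by norm_num))
    linarith
  · have : (√‖z‖ ^ 2)⁻¹ ≤ 1 := inv_le_one_of_one_le₀ (one_le_pow₀ (not_le.mp h1).le)
    have : 0 ≤ (√‖z‖ ^ 3)⁻¹ := by positivity
    linarith

noncomputable def HH (b : ℝ) (z : E2) : E2 := (‖z‖ ^ 2 + b ^ 4)⁻¹ • z

lemma norm_HH_le {b : ℝ} (hb : 0 < b) (z : E2) : ‖HH b z‖ ≤ (b ^ 2)⁻¹ := by
  unfold HH
  rw [norm_smul, norm_inv, Real.norm_of_nonneg (by positivity), inv_mul_eq_div,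
    div_le_iff₀ (by positivity), inv_mul_eq_div, le_div_iff₀ (by positivity)]
  nlinarith [sq_nonneg (‖z‖ - b ^ 2), norm_nonneg z, sq_nonneg b]

lemma GG_sub_HH {b : ℝ} (hb : 0 < b) (z : E2) : ‖GG z - HH b z‖ ≤ b * kap z := by
  by_cases h : ‖z‖ = 0
  · have : z = 0 := norm_eq_zero.mp h
    simp [this, GG, HH, kap]
  have hp : 0 < ‖z‖ := lt_of_le_of_ne (norm_nonneg _) (Ne.symm h)
  unfold GG HH kap
  rw [← sub_smul, norm_smul]
  have hs : 0 < √‖z‖ := Real.sqrt_pos.mpr hp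
  have e : ‖z‖ = √‖z‖ ^ 2 := (Real.sq_sqrt hp.le).symm
  rw [e]
  rw [Real.sqrt_sq hs.le]
  set a := √‖z‖
  have e2 : ((a ^ 2) ^ 2)⁻¹ - ((a ^ 2) ^ 2 + b ^ 4)⁻¹ = b ^ 4 / (a ^ 4 * (a ^ 4 + b ^ 4)) := by
    have : (a ^ 2) ^ 2 + b ^ 4 ≠ 0 := by positivity
    field_simp
    ring
  rw [e2, Real.norm_of_nonneg (by positivity)]
  have e3 : b * (a ^ 3)⁻¹ - b ^ 4 / (a ^ 4 * (a ^ 4 + b ^ 4)) * a ^ 2 =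
    b * (a ^ 4 + b ^ 4 - b ^ 3 * a) / (a ^ 3 * (a ^ 4 + b ^ 4)) := by
    have : a ^ 4 + b ^ 4 ≠ 0 := by positivity
    field_simp
  rw [← sub_nonneg, e3]
  have : 0 ≤ a ^ 4 + b ^ 4 - b ^ 3 * a := by
    nlinarith [sq_nonneg (a ^ 2 - b ^ 2), sq_nonneg (a * b - b ^ 2), sq_nonneg (a * b),
      sq_nonneg (a ^ 2), sq_nonneg (b ^ 2)]
  positivity

lemma log_sub_le {b : ℝ} (hb : 0 < b) {z : E2} (hz : z ≠ 0) :
    |1 / 2 * Real.log (‖z‖ ^ 2 + b ^ 4) - Real.log ‖z‖| ≤ b ^ 2 * (kap z + 1) := by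
  have hp : 0 < ‖z‖ := norm_pos_iff.mpr hz
  have e : Real.log ‖z‖ = 1 / 2 * Real.log (‖z‖ ^ 2) := by
    rw [Real.log_pow]; push_cast; ring
  have h1 : Real.log (‖z‖ ^ 2) ≤ Real.log (‖z‖ ^ 2 + b ^ 4) :=
    Real.log_le_log (by positivity) (by linarith [pow_pos hb 4])
  rw [abs_of_nonneg (by rw [e]; linarith)]
  have h2 : Real.log (‖z‖ ^ 2 + b ^ 4) ≤ Real.log ((‖z‖ * (1 + b ^ 2 * ‖z‖⁻¹)) ^ 2) := by
    apply Real.log_le_log (by positivity)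
    have : ‖z‖ * (1 + b ^ 2 * ‖z‖⁻¹) = ‖z‖ + b ^ 2 := by field_simp
    rw [this]
    nlinarith [mul_pos hp (pow_pos hb 2)]
  rw [Real.log_pow, Real.log_mul hp.ne' (by positivity)] at h2
  have h3 : Real.log (1 + b ^ 2 * ‖z‖⁻¹) ≤ b ^ 2 * ‖z‖⁻¹ := by
    have := Real.log_le_sub_one_of_pos (show 0 < 1 + b ^ 2 * ‖z‖⁻¹ by positivity)
    linarith
  have h4 := mul_le_mul_of_nonneg_left (inv_norm_le_kap z) (sq_nonneg b)
  push_cast at h2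
  linarith

lemma abs_log_norm_le (z : E2) : |Real.log ‖z‖| ≤ ‖z‖ + (kap z + 1) := by
  have h4 := inv_norm_le_kap z
  have hk := kap_nonneg z
  have h1 := Real.log_le_self (norm_nonneg z)
  have h2 := Real.log_le_self (inv_nonneg.mpr (norm_nonneg z))
  rw [Real.log_inv] at h2
  have := norm_nonneg z
  rw [abs_le]
  constructor <;> linarith

section
variable {ω : E2 → ℝ}

lemma kap_conv_bound (hc : Continuous ω) (hs : HasCompactSupport ω) :
    (∀ x, Integrable (fun y => kap (x - y) * |ω y|)) ∧
    ∃ B, 0 ≤ B ∧ ∀ x, ∫ y, kap (x - y) * |ω y| ≤ B := by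
  obtain ⟨M, hM⟩ := hs.exists_bound_of_continuous hc
  have hM0 : 0 ≤ M := (norm_nonneg _).trans (hM 0)
  have hω : Integrable (fun y => |ω y|) := (hc.integrable_of_hasCompactSupport hs).abs
  have hdom : ∀ x : E2, Integrable (fun y =>
      M * (Metric.ball (0 : E2) 1).indicator kap (x - y) + |ω y|) := fun x =>
    ((kap_integrable.comp_sub_left x).const_mul M).add hω
  have hle : ∀ x y : E2, kap (x - y) * |ω y| ≤
      M * (Metric.ball (0 : E2) 1).indicator kap (x - y) + |ω y| := by
    intro x y
    have h1 := hM y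
    rw [Real.norm_eq_abs] at h1
    have hk := kap_nonneg (x - y)
    by_cases h : x - y ∈ Metric.ball (0 : E2) 1
    · rw [Set.indicator_of_mem h]
      nlinarith [abs_nonneg (ω y), mul_le_mul_of_nonneg_left h1 hk]
    · rw [Set.indicator_of_notMem h]
      have : 1 ≤ ‖x - y‖ := by simpa using h
      have := kap_le_one this
      nlinarith [abs_nonneg (ω y)]
  have hint : ∀ x, Integrable (fun y => kap (x - y) * |ω y|) := by
    intro x
    refine (hdom x).mono' ?_ (Filter.Eventually.of_forall fun y => ?_)
    · exact ((measurable_kap.comp (measurable_const.sub measurable_id)).mul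
        hc.measurable.abs).aestronglyMeasurable
    · rw [Real.norm_of_nonneg (mul_nonneg (kap_nonneg _) (abs_nonneg _))]
      exact hle x y
  refine ⟨hint, M * (∫ z, (Metric.ball (0 : E2) 1).indicator kap z) + ∫ y, |ω y|, ?_, ?_⟩
  · have : 0 ≤ ∫ z, (Metric.ball (0 : E2) 1).indicator kap z :=
      integral_nonneg fun z => Set.indicator_nonneg (fun z _ => kap_nonneg z) z
    have : 0 ≤ ∫ y, |ω y| := integral_nonneg fun z => abs_nonneg _
    positivity
  · intro x
    refine (integral_mono (hint x) (hdom x) (hle x)).trans (le_of_eq ?_)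
    rw [integral_add ((kap_integrable.comp_sub_left x).const_mul M) hω, integral_const_mul,
      integral_sub_left_eq_self (fun z => (Metric.ball (0 : E2) 1).indicator kap z)]

lemma integrable_kap1 (hc : Continuous ω) (hs : HasCompactSupport ω) (x : E2) :
    Integrable (fun y => (kap (x - y) + 1) * |ω y|) := by
  have hω : Integrable (fun y => |ω y|) := (hc.integrable_of_hasCompactSupport hs).abs
  refine (((kap_conv_bound hc hs).1 x).add hω).congr (Filter.Eventually.of_forall fun y => ?_)
  simp only [Pi.add_apply]; ring

lemma integrable_GG (hc : Continuous ω) (hs : HasCompactSupport ω) (x : E2) :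
    Integrable (fun y => ω y • GG (x - y)) := by
  refine (integrable_kap1 hc hs x).mono' ?_ (Filter.Eventually.of_forall fun y => ?_)
  · have : Measurable (fun y => ω y • GG (x - y)) := by
      have := hc.measurable
      unfold GG; fun_prop
    exact this.aestronglyMeasurable
  · rw [norm_smul, norm_GG, mul_comm, Real.norm_eq_abs]
    exact mul_le_mul_of_nonneg_right (inv_norm_le_kap _) (abs_nonneg _)

lemma integrable_HH (hc : Continuous ω) (hs : HasCompactSupport ω) {b : ℝ} (hb : 0 < b) (x : E2) :
    Integrable (fun y => ω y • HH b (x - y)) := by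
  have hω : Integrable (fun y => |ω y|) := (hc.integrable_of_hasCompactSupport hs).abs
  refine (hω.const_mul ((b ^ 2)⁻¹)).mono' ?_ (Filter.Eventually.of_forall fun y => ?_)
  · have : Measurable (fun y => ω y • HH b (x - y)) := by
      have := hc.measurable
      unfold HH; fun_prop
    exact this.aestronglyMeasurable
  · rw [norm_smul, mul_comm, Real.norm_eq_abs]
    exact mul_le_mul_of_nonneg_right (norm_HH_le hb _) (abs_nonneg _)

lemma integrable_log (hc : Continuous ω) (hs : HasCompactSupport ω) (x : E2) :
    Integrable (fun y => Real.log ‖x - y‖ * ω y) := by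
  have h1 : Integrable (fun y => ‖x - y‖ * |ω y|) :=
    ((continuous_const.sub continuous_id).norm.mul hc.abs).integrable_of_hasCompactSupport
      (hs.abs.mul_left)
  refine (h1.add (integrable_kap1 hc hs x)).mono' ?_ (Filter.Eventually.of_forall fun y => ?_)
  · have : Measurable (fun y => Real.log ‖x - y‖ * ω y) := by
      have := hc.measurable
      fun_prop
    exact this.aestronglyMeasurable
  · rw [norm_mul, Real.norm_eq_abs, Real.norm_eq_abs]
    simp only [Pi.add_apply]
    rw [← add_mul]
    exact mul_le_mul_of_nonneg_right (abs_log_norm_le _) (abs_nonneg _)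

lemma integrable_logb (hc : Continuous ω) (hs : HasCompactSupport ω) {b : ℝ} (hb : 0 < b) (x : E2) :
    Integrable (fun y => 1 / 2 * Real.log (‖x - y‖ ^ 2 + b ^ 4) * ω y) := by
  refine Continuous.integrable_of_hasCompactSupport ?_ hs.mul_left
  refine (continuous_const.mul (Continuous.log (by fun_prop) fun y => ?_)).mul hc
  positivity

lemma hasFDerivAt_logb {b : ℝ} (hb : 0 < b) (z : E2) :
    HasFDerivAt (fun z : E2 => 1 / 2 * Real.log (‖z‖ ^ 2 + b ^ 4)) (innerSL ℝ (HH b z)) z := by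
  have h1 := ((hasStrictFDerivAt_norm_sq z).hasFDerivAt.add_const (b ^ 4))
  have h2 := (h1.log (by positivity)).const_mul (1 / 2)
  refine h2.congr_fderiv ?_
  ext1 x
  simp [HH]
  ring

lemma integral_innerSL {V : E2 → E2} (hV : Integrable V) :
    ∫ y, innerSL ℝ (V y) = innerSL ℝ (∫ y, V y) := by
  have hi : Integrable (fun y => innerSL ℝ (V y)) := by
    refine (hV.norm).mono' ?_ (Filter.Eventually.of_forall fun y => ?_)
    · exact (innerSL ℝ).continuous.comp_aestronglyMeasurable hV.1
    · rw [innerSL_apply_norm]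
  ext1 v
  rw [ContinuousLinearMap.integral_apply hi]
  simp only [innerSL_apply_apply]
  simp_rw [real_inner_comm v]
  exact integral_inner hV v

lemma hasFDerivAt_potb (hc : Continuous ω) (hs : HasCompactSupport ω) {b : ℝ} (hb : 0 < b)
    (x : E2) : HasFDerivAt (fun x => ∫ y, 1 / 2 * Real.log (‖x - y‖ ^ 2 + b ^ 4) * ω y)
      (innerSL ℝ (∫ y, ω y • HH b (x - y))) x := by
  have hω : Integrable (fun y => |ω y|) := (hc.integrable_of_hasCompactSupport hs).abs
  rw [← integral_innerSL (integrable_HH hc hs hb x)]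
  refine hasFDerivAt_integral_of_dominated_of_fderiv_le
    (F' := fun x y => innerSL ℝ (ω y • HH b (x - y)))
    (bound := fun y => (b ^ 2)⁻¹ * |ω y|) (s := Set.univ) Filter.univ_mem
    (Filter.Eventually.of_forall fun x => (integrable_logb hc hs hb x).1)
    (integrable_logb hc hs hb x) 
    ((innerSL ℝ).continuous.comp_aestronglyMeasurable (integrable_HH hc hs hb x).1)
    (Filter.Eventually.of_forall fun y x _ => ?_) (hω.const_mul _)
    (Filter.Eventually.of_forall fun y x _ => ?_)
  · rw [innerSL_apply_norm, norm_smul, mul_comm, Real.norm_eq_abs]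
    exact mul_le_mul_of_nonneg_right (norm_HH_le hb _) (abs_nonneg _)
  · have h1 := (hasFDerivAt_logb hb (x - y)).comp x ((hasFDerivAt_id x).sub_const y)
    have h2 := h1.mul_const (ω y)
    refine h2.congr_fderiv ?_
    ext1 v
    simp

lemma hasFDerivAt_pot (hc : Continuous ω) (hs : HasCompactSupport ω) (x : E2) :
    HasFDerivAt (fun x => ∫ y, Real.log ‖x - y‖ * ω y) (innerSL ℝ (∫ y, ω y • GG (x - y))) x := by
  obtain ⟨hint, B, hB0, hB⟩ := kap_conv_bound hc hs
  have hb : ∀ n : ℕ, 0 < 1 / ((n : ℝ) + 1) := fun n => by positivity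
  have hlim := tendsto_one_div_add_atTop_nhds_zero_nat (𝕜 := ℝ)
  refine hasFDerivAt_of_tendstoUniformly (l := Filter.atTop)
    (f := fun (n : ℕ) x => ∫ y, 1 / 2 * Real.log (‖x - y‖ ^ 2 + (1 / ((n : ℝ) + 1)) ^ 4) * ω y)
    (f' := fun (n : ℕ) x => innerSL ℝ (∫ y, ω y • HH (1 / ((n : ℝ) + 1)) (x - y)))
    (g' := fun x => innerSL ℝ (∫ y, ω y • GG (x - y))) ?_
    (fun n x => hasFDerivAt_potb hc hs (hb n) x) ?_ x
  · rw [Metric.tendstoUniformly_iff]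
    intro ε hε
    have h1 : Filter.Tendsto (fun n : ℕ => 1 / ((n : ℝ) + 1) * B) Filter.atTop (nhds 0) := by
      simpa using hlim.mul_const B
    filter_upwards [h1.eventually (gt_mem_nhds hε)] with n hn x
    refine lt_of_le_of_lt ?_ hn
    rw [dist_eq_norm, ← map_sub, innerSL_apply_norm,
      ← integral_sub (integrable_GG hc hs x) (integrable_HH hc hs (hb n) x)]
    calc _ ≤ ∫ y, 1 / ((n : ℝ) + 1) * (kap (x - y) * |ω y|) := by
          refine norm_integral_le_of_norm_le ((hint x).const_mul _)
            (Filter.Eventually.of_forall fun y => ?_)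
          rw [← smul_sub, norm_smul, Real.norm_eq_abs, mul_comm, ← mul_assoc]
          exact mul_le_mul_of_nonneg_right (GG_sub_HH (hb n) _) (abs_nonneg _)
      _ ≤ _ := by
          rw [integral_const_mul]
          exact mul_le_mul_of_nonneg_left (hB x) (hb n).le
  · intro x
    rw [tendsto_iff_norm_sub_tendsto_zero]
    have h1 : Filter.Tendsto (fun n : ℕ => (1 / ((n : ℝ) + 1)) ^ 2 *
        ∫ y, (kap (x - y) + 1) * |ω y|) Filter.atTop (nhds 0) := by
      simpa using (hlim.pow 2).mul_const (∫ y, (kap (x - y) + 1) * |ω y|)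
    refine squeeze_zero (fun n => norm_nonneg _) (fun n => ?_) h1
    rw [← integral_sub (integrable_logb hc hs (hb n) x) (integrable_log hc hs x),
      ← integral_const_mul]
    refine norm_integral_le_of_norm_le ((integrable_kap1 hc hs x).const_mul _) ?_
    have hne : ∀ᵐ y : E2, y ≠ x := by
      simp [ae_iff]
    filter_upwards [hne] with y hy
    rw [← sub_mul, norm_mul, Real.norm_eq_abs, Real.norm_eq_abs, ← mul_assoc]
    exact mul_le_mul_of_nonneg_right (log_sub_le (hb n) (sub_ne_zero.mpr hy.symm)) (abs_nonneg _)

end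

noncomputable def VV (ω : E2 → ℝ) (x : E2) : E2 := (1 / (2 * π)) • ∫ y, ω y • GG (x - y)

noncomputable def DVV (ω : E2 → ℝ) (x : E2) : E2 →L[ℝ] E2 :=
  (1 / (2 * π)) • ∫ y, ω y • DGc (GG (x - y))

lemma two_pi_inv_le : 1 / (2 * π) ≤ 1 := by
  rw [div_le_one (by positivity)]
  linarith [Real.pi_gt_three]

section
variable {ω : E2 → ℝ}

lemma biot_eq (hc : Continuous ω) (hs : HasCompactSupport ω) (x : E2) :
    biotSavart2D ω x = perpL (VV ω x) := by
  unfold biotSavart2D VV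
  rw [map_smul, ← ContinuousLinearMap.integral_comp_comm _ (integrable_GG hc hs x)]
  congr 1
  refine integral_congr_ae (Filter.Eventually.of_forall fun y => ?_)
  simp only [GG, map_smul, smul_smul, perpL_apply]
  rfl

lemma hasFDerivAt_streamR (hc : Continuous ω) (hs : HasCompactSupport ω) (m R : ℝ) (x : E2) :
    HasFDerivAt (streamR ω m R) (innerSL ℝ (VV ω x)) x := by
  have h := ((hasFDerivAt_pot hc hs x).const_mul (1 / (2 * π))).sub_const
    ((m / (2 * π)) * Real.log R)
  refine h.congr_fderiv ?_
  unfold VV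
  ext1 v
  simp

lemma measurable_DG (hc : Continuous ω) (x : E2) :
    Measurable (fun y => ω y • DGc (GG (x - y))) := by
  have hm := hc.measurable
  have hD : Continuous DGc := by
    unfold DGc
    have : Continuous fun w : E2 => (innerSL ℝ w).smulRight w := by
      have h1 : Continuous (fun w : E2 => (innerSL ℝ w : E2 →L[ℝ] ℝ)) := (innerSL ℝ).continuous
      exact ((ContinuousLinearMap.smulRightL ℝ E2 E2).continuous₂).comp (h1.prodMk continuous_id)
    fun_prop
  have hG : Measurable GG := by unfold GG; fun_prop
  exact hm.smul (hD.measurable.comp (hG.comp (measurable_const.sub measurable_id)))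

lemma norm_sub_ge {R₀ : ℝ} {x y : E2} (hy : ‖y‖ ≤ R₀) : ‖x‖ - R₀ ≤ ‖x - y‖ := by
  have := norm_sub_norm_le x y
  linarith

lemma norm_DG_le {R₀ : ℝ} (h0 : 0 < R₀) (hsupp : ∀ y, ω y ≠ 0 → ‖y‖ ≤ R₀) {x : E2}
    (hx : 2 * R₀ ≤ ‖x‖) (y : E2) :
    ‖ω y • DGc (GG (x - y))‖ ≤ 3 * (R₀⁻¹) ^ 2 * |ω y| := by
  rw [norm_smul, mul_comm, Real.norm_eq_abs]
  by_cases hy : ω y = 0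
  · simp [hy]
  refine mul_le_mul_of_nonneg_right ((norm_DGc_le _).trans ?_) (abs_nonneg _)
  have := norm_sub_ge (x := x) (hsupp y hy)
  rw [norm_GG]
  have : ‖x - y‖⁻¹ ≤ R₀⁻¹ := inv_anti₀ h0 (by linarith)
  gcongr

lemma integrable_DG (hc : Continuous ω) (hs : HasCompactSupport ω) {R₀ : ℝ} (h0 : 0 < R₀)
    (hsupp : ∀ y, ω y ≠ 0 → ‖y‖ ≤ R₀) {x : E2} (hx : 2 * R₀ ≤ ‖x‖) :
    Integrable (fun y => ω y • DGc (GG (x - y))) := by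
  have hω : Integrable (fun y => |ω y|) := (hc.integrable_of_hasCompactSupport hs).abs
  exact (hω.const_mul (3 * (R₀⁻¹) ^ 2)).mono' (measurable_DG hc x).aestronglyMeasurable
    (Filter.Eventually.of_forall fun y => norm_DG_le h0 hsupp hx y)

lemma hasFDerivAt_VV (hc : Continuous ω) (hs : HasCompactSupport ω) {R₀ : ℝ} (h0 : 0 < R₀)
    (hsupp : ∀ y, ω y ≠ 0 → ‖y‖ ≤ R₀) {x : E2} (hx : 2 * R₀ < ‖x‖) :
    HasFDerivAt (VV ω) (DVV ω x) x := by
  have hω : Integrable (fun y => |ω y|) := (hc.integrable_of_hasCompactSupport hs).abs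
  refine HasFDerivAt.const_smul ?_ (1 / (2 * π))
  refine hasFDerivAt_integral_of_dominated_of_fderiv_le
    (F' := fun x y => ω y • DGc (GG (x - y)))
    (bound := fun y => 3 * (R₀⁻¹) ^ 2 * |ω y|) (s := {x : E2 | 2 * R₀ < ‖x‖})
    ((isOpen_lt continuous_const continuous_norm).mem_nhds hx)
    (Filter.Eventually.of_forall fun x => (integrable_GG hc hs x).1)
    (integrable_GG hc hs x) (measurable_DG hc x).aestronglyMeasurable
    (Filter.Eventually.of_forall fun y x hx => ?_) (hω.const_mul _)
    (Filter.Eventually.of_forall fun y x hx => ?_)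
  · exact norm_DG_le h0 hsupp (le_of_lt hx) y
  · by_cases hy : ω y = 0
    · have e0 : ω y • DGc (GG (x - y)) = 0 := by
        rw [hy]
        exact zero_smul ℝ (DGc (GG (x - y)))
      have h3 : HasFDerivAt (fun x : E2 => ω y • GG (x - y)) (0 : E2 →L[ℝ] E2) x := by
        simp only [hy, zero_smul]
        exact hasFDerivAt_const (𝕜 := ℝ) (0 : E2) x
      exact h3.congr_fderiv e0.symm
    · have h1 := norm_sub_ge (x := x) (hsupp y hy)
      have hx' : 2 * R₀ < ‖x‖ := hx
      have h2 : x - y ≠ 0 := norm_pos_iff.mp (by linarith)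
      have h3 := (hasFDerivAt_GG h2).comp x ((hasFDerivAt_id x).sub_const y)
      exact h3.const_smul (ω y)

lemma generic_bound {F : Type*} [NormedAddCommGroup F] [NormedSpace ℝ F] [CompleteSpace F]
    (hω : Integrable ω) (k : E2 → F) (k0 : F) (hk : Integrable (fun y => ω y • k y)) {c : ℝ}
    (h : ∀ y, ω y ≠ 0 → ‖k y - k0‖ ≤ c) :
    ‖(1 / (2 * π)) • ∫ y, ω y • k y‖ ≤ |∫ y, ω y| * ‖k0‖ + (∫ y, |ω y|) * c := by
  have h1 : ∫ y, ω y • k y = (∫ y, ω y) • k0 + ∫ y, (ω y • k y - ω y • k0) := by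
    rw [integral_sub hk (hω.smul_const k0), integral_smul_const]
    abel
  have h2 : ‖∫ y, (ω y • k y - ω y • k0)‖ ≤ ∫ y, |ω y| * c := by
    refine norm_integral_le_of_norm_le (hω.abs.mul_const c)
      (Filter.Eventually.of_forall fun y => ?_)
    rw [← smul_sub, norm_smul, Real.norm_eq_abs]
    by_cases hy : ω y = 0
    · simp [hy]
    · exact mul_le_mul_of_nonneg_left (h y hy) (abs_nonneg _)
  rw [integral_mul_const] at h2
  rw [norm_smul, Real.norm_of_nonneg (by positivity)]
  refine (mul_le_of_le_one_left (norm_nonneg _) two_pi_inv_le).trans ?_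
  rw [h1]
  refine (norm_add_le _ _).trans ?_
  rw [norm_smul, Real.norm_eq_abs]
  linarith

variable {R₀ R : ℝ} {x : E2}

lemma bound_VV (hc : Continuous ω) (hs : HasCompactSupport ω) (h0 : 0 < R₀)
    (hsupp : ∀ y, ω y ≠ 0 → ‖y‖ ≤ R₀) (hR : 4 * R₀ ≤ R) (hx : 3 / 4 * R ≤ ‖x‖) :
    ‖VV ω x‖ ≤ |∫ y, ω y| * (2 / R) + (∫ y, |ω y|) * (3 * R₀ / R ^ 2) := by
  have hRp : 0 < R := by linarith
  have hxp : 0 < ‖x‖ := by linarith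
  have hi : ‖x‖⁻¹ ≤ (3 / 4 * R)⁻¹ := inv_anti₀ (by positivity) hx
  refine (generic_bound (hc.integrable_of_hasCompactSupport hs) (fun y => GG (x - y)) (GG x)
    (integrable_GG hc hs x) (c := 3 * R₀ / R ^ 2) fun y hy => ?_).trans ?_
  · have h1 := norm_sub_ge (x := x) (hsupp y hy)
    have h1' : 1 / 2 * R ≤ ‖x - y‖ := by linarith
    have hp : 0 < ‖x - y‖ := by linarith
    rw [GG_sub (norm_pos_iff.mp hp) (norm_pos_iff.mp hxp)]
    have e : x - y - x = -y := by abel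
    rw [e, norm_neg]
    calc _ ≤ R₀ / ((1 / 2 * R) * (3 / 4 * R)) := by
          gcongr
          exact hsupp y hy
      _ ≤ _ := by
          rw [div_le_div_iff₀ (by positivity) (by positivity)]
          nlinarith [mul_pos h0 (mul_pos hRp hRp)]
  · have : ‖GG x‖ ≤ 2 / R := by
      rw [norm_GG]
      refine hi.trans ?_
      rw [inv_le_iff_one_le_mul₀ (by positivity)]
      field_simp
      norm_num
    gcongr

lemma bound_DVV (hc : Continuous ω) (hs : HasCompactSupport ω) (h0 : 0 < R₀)
    (hsupp : ∀ y, ω y ≠ 0 → ‖y‖ ≤ R₀) (hR : 4 * R₀ ≤ R) (hx : 3 / 4 * R ≤ ‖x‖) :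
    ‖DVV ω x‖ ≤ |∫ y, ω y| * (6 / R ^ 2) + (∫ y, |ω y|) * (27 * R₀ / R ^ 3) := by
  have hRp : 0 < R := by linarith
  have hxp : 0 < ‖x‖ := by linarith
  have hi : ‖x‖⁻¹ ≤ (3 / 4 * R)⁻¹ := inv_anti₀ (by positivity) hx
  refine (generic_bound (hc.integrable_of_hasCompactSupport hs) (fun y => DGc (GG (x - y)))
    (DGc (GG x)) (integrable_DG hc hs h0 hsupp (by linarith)) (c := 27 * R₀ / R ^ 3)
    fun y hy => ?_).trans ?_
  · have h1 := norm_sub_ge (x := x) (hsupp y hy)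
    have h1' : 1 / 2 * R ≤ ‖x - y‖ := by linarith
    have hp : 0 < ‖x - y‖ := by linarith
    have hi2 : ‖x - y‖⁻¹ ≤ (1 / 2 * R)⁻¹ := inv_anti₀ (by positivity) h1'
    refine (norm_DGc_sub_le _ _).trans ?_
    rw [GG_sub (norm_pos_iff.mp hp) (norm_pos_iff.mp hxp), norm_GG, norm_GG]
    have e : x - y - x = -y := by abel
    rw [e, norm_neg]
    calc _ ≤ 3 * ((1 / 2 * R)⁻¹ + (3 / 4 * R)⁻¹) * (R₀ / ((1 / 2 * R) * (3 / 4 * R))) := by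
          gcongr
          exact hsupp y hy
      _ = (80 / 3) * R₀ / R ^ 3 := by
          field_simp
          norm_num
      _ ≤ _ := by
          gcongr
          norm_num
  · have : ‖DGc (GG x)‖ ≤ 6 / R ^ 2 := by
      refine (norm_DGc_le _).trans ?_
      rw [norm_GG]
      calc _ ≤ 3 * ((3 / 4 * R)⁻¹) ^ 2 := by gcongr
        _ = (16 / 3) / R ^ 2 := by field_simp; norm_num
        _ ≤ _ := by gcongr; norm_num
    gcongr

lemma abs_log_sub_log_le {a b c : ℝ} (hc : 0 < c) (ha : c ≤ a) (hb : c ≤ b) :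
    |Real.log a - Real.log b| ≤ |a - b| / c := by
  have key : ∀ a b : ℝ, c ≤ a → c ≤ b → Real.log a - Real.log b ≤ |a - b| / c := by
    intro a b ha hb
    have ha' : 0 < a := by linarith
    have hb' : 0 < b := by linarith
    rw [← Real.log_div ha'.ne' hb'.ne']
    refine (Real.log_le_sub_one_of_pos (by positivity)).trans ?_
    have : a / b - 1 = (a - b) / b := by field_simp
    rw [this]
    calc _ ≤ |a - b| / b := by gcongr; exact le_abs_self _
      _ ≤ _ := by gcongr
  rw [abs_le]
  have h1 := key a b ha hb
  have h2 := key b a hb ha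
  rw [abs_sub_comm] at h2
  constructor <;> linarith

lemma bound_streamR (hc : Continuous ω) (hs : HasCompactSupport ω) (h0 : 0 < R₀)
    (hsupp : ∀ y, ω y ≠ 0 → ‖y‖ ≤ R₀) (hR : 4 * R₀ ≤ R) (hx : 3 / 4 * R ≤ ‖x‖) (hx2 : ‖x‖ ≤ R) :
    |streamR ω (∫ y, ω y) R x| ≤
      |∫ y, ω y| * ((R - ‖x‖) / (3 / 4 * R)) + (∫ y, |ω y|) * (2 * R₀ / R) := by
  have hRp : 0 < R := by linarith
  have hxp : 0 < ‖x‖ := by linarith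
  have hω : Integrable ω := hc.integrable_of_hasCompactSupport hs
  have hl : Integrable (fun y => ω y * Real.log ‖x - y‖) := by
    simpa only [mul_comm] using integrable_log hc hs x
  have hk : Integrable (fun y => ω y • (Real.log ‖x - y‖ - Real.log R)) := by
    simp only [smul_eq_mul, mul_sub]
    exact hl.sub (hω.mul_const _)
  have e : streamR ω (∫ y, ω y) R x =
      (1 / (2 * π)) • ∫ y, ω y • (Real.log ‖x - y‖ - Real.log R) := by
    unfold streamR
    simp only [smul_eq_mul, mul_sub]
    rw [integral_sub hl (hω.mul_const _), integral_mul_const]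
    simp only [mul_comm (ω _)]
    ring
  rw [e, ← Real.norm_eq_abs]
  refine (generic_bound hω (fun y => Real.log ‖x - y‖ - Real.log R)
    (Real.log ‖x‖ - Real.log R) hk (c := 2 * R₀ / R) fun y hy => ?_).trans ?_
  · have h1 := norm_sub_ge (x := x) (hsupp y hy)
    have h1' : 1 / 2 * R ≤ ‖x - y‖ := by linarith
    rw [sub_sub_sub_cancel_right, Real.norm_eq_abs]
    refine (abs_log_sub_log_le (c := 1 / 2 * R) (by positivity) h1' (by linarith)).trans ?_
    have h2 : |‖x - y‖ - ‖x‖| ≤ R₀ := by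
      refine (abs_norm_sub_norm_le _ _).trans ?_
      have e : x - y - x = -y := by abel
      rw [e, norm_neg]
      exact hsupp y hy
    calc _ ≤ R₀ / (1 / 2 * R) := by gcongr
      _ = _ := by field_simp
  · have : ‖Real.log ‖x‖ - Real.log R‖ ≤ (R - ‖x‖) / (3 / 4 * R) := by
      rw [Real.norm_eq_abs]
      refine (abs_log_sub_log_le (c := 3 / 4 * R) (by positivity) hx (by linarith)).trans ?_
      rw [abs_sub_comm, abs_of_nonneg (by linarith)]
    gcongr

end

noncomputable def pp (g : ℝ → ℝ) (q R : ℝ) (x : E2) : E2 :=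
  (-(q * deriv g (q * (R - ‖x‖)))) • nn x

noncomputable def Dpp (g : ℝ → ℝ) (q R : ℝ) (x : E2) : E2 →L[ℝ] E2 :=
  (-(q * deriv g (q * (R - ‖x‖)))) • Dnn x +
    (innerSL ℝ ((q ^ 2 * deriv (deriv g) (q * (R - ‖x‖))) • nn x)).smulRight (nn x)

lemma hasFDerivAt_arg (q R : ℝ) {x : E2} (hx : x ≠ 0) :
    HasFDerivAt (fun x : E2 => q * (R - ‖x‖)) (innerSL ℝ ((-q) • nn x)) x := by
  refine (((hasFDerivAt_norm' hx).const_sub R).const_mul q).congr_fderiv ?_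
  ext1 v
  simp

lemma hasFDerivAt_cutoff {g : ℝ → ℝ} (hg : Differentiable ℝ g) (θ R : ℝ) {x : E2} (hx : x ≠ 0) :
    HasFDerivAt (cutoff g θ R) (innerSL ℝ (pp g (R ^ (-θ)) R x)) x := by
  have h := (hg (R ^ (-θ) * (R - ‖x‖))).hasDerivAt.comp_hasFDerivAt x
    (hasFDerivAt_arg (R ^ (-θ)) R hx)
  refine HasFDerivAt.congr_fderiv (f := cutoff g θ R) h ?_
  ext1 v
  simp [pp]
  ring

lemma hasFDerivAt_pp {g : ℝ → ℝ} (hg : Differentiable ℝ (deriv g)) (q R : ℝ) {x : E2}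
    (hx : x ≠ 0) : HasFDerivAt (pp g q R) (Dpp g q R x) x := by
  have h := ((hg (q * (R - ‖x‖))).hasDerivAt.comp_hasFDerivAt x
    (hasFDerivAt_arg q R hx)).const_mul (-q)
  have h2 := h.smul (hasFDerivAt_nn hx)
  have h3 : HasFDerivAt (pp g q R) _ x :=
    h2.congr_of_eventuallyEq (Filter.Eventually.of_forall fun z => by
      simp [pp])
  refine h3.congr_fderiv ?_
  ext1 v
  simp [Dpp]
  congr 1
  ring

lemma norm_pp_le {g : ℝ → ℝ} {q R M : ℝ} (hq : 0 ≤ q) {x : E2} (hx : x ≠ 0)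
    (h : |deriv g (q * (R - ‖x‖))| ≤ M) : ‖pp g q R x‖ ≤ q * M := by
  unfold pp
  rw [norm_smul, norm_nn hx, mul_one, norm_neg, norm_mul, Real.norm_of_nonneg hq,
    Real.norm_eq_abs]
  gcongr

lemma norm_Dpp_le {g : ℝ → ℝ} {q R M M' : ℝ} (hq : 0 ≤ q) {x : E2} (hx : x ≠ 0)
    (h : |deriv g (q * (R - ‖x‖))| ≤ M) (h' : |deriv (deriv g) (q * (R - ‖x‖))| ≤ M') :
    ‖Dpp g q R x‖ ≤ q * M * (2 * ‖x‖⁻¹) + q ^ 2 * M' := by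
  unfold Dpp
  refine (norm_add_le _ _).trans ?_
  rw [norm_smul, ContinuousLinearMap.norm_smulRight_apply, innerSL_apply_norm, norm_smul,
    norm_nn hx, mul_one, mul_one, norm_neg, norm_mul, norm_mul, Real.norm_of_nonneg hq,
    Real.norm_of_nonneg (sq_nonneg q), Real.norm_eq_abs, Real.norm_eq_abs]
  have := norm_Dnn_le hx
  have hM : 0 ≤ M := (abs_nonneg _).trans h
  gcongr

lemma arith_main {R q S m R₀ M M' i w dv v ps p dp : ℝ} (hRp : 0 < R) (hq : 0 < q)
    (hq1 : 1 / R ≤ q) (hS : 0 ≤ S) (hm : 0 ≤ m) (h0 : 0 < R₀) (hM : 0 ≤ M) (hM' : 0 ≤ M')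
    (hv0 : 0 ≤ v) (hp0 : 0 ≤ p) (hps0 : 0 ≤ ps) (hdp0 : 0 ≤ dp)
    (hi' : 2 * i ≤ 3 * q) (e2 : w ≤ (1 / R) / q)
    (hp : p ≤ q * M) (hDp : dp ≤ q * M * (2 * i) + q ^ 2 * M')
    (hV : v ≤ m * (2 / R) + S * (3 * R₀ / R ^ 2))
    (hDV : dv ≤ m * (6 / R ^ 2) + S * (27 * R₀ / R ^ 3))
    (hψ : ps ≤ m * w + S * (2 * R₀ / R)) :
    dv + 2 * (p * v) + ps * dp ≤ (R₀ * (27 + 12 * M + 2 * M') + (6 + 7 * M + M')) *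
        (S * (q ^ 2 / R) + m * (q / R)) := by
  set ρ := 1 / R with hρ
  have hρ0 : 0 < ρ := by positivity
  have hDp' : dp ≤ q ^ 2 * (3 * M + M') := by
    refine hDp.trans ?_
    have := mul_le_mul_of_nonneg_left hi' (mul_nonneg hq.le hM)
    nlinarith
  have hψ' : ps ≤ m * (ρ / q) + S * (2 * R₀ * ρ) := by
    refine hψ.trans ?_
    have e1 : 2 * R₀ / R = 2 * R₀ * ρ := by rw [hρ]; field_simp
    rw [e1]
    gcongr
  have hV' : v ≤ m * (2 * ρ) + S * (3 * R₀ * ρ ^ 2) := by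
    refine hV.trans (le_of_eq ?_)
    rw [hρ]; field_simp
  have hDV' : dv ≤ m * (6 * ρ ^ 2) + S * (27 * R₀ * ρ ^ 3) := by
    refine hDV.trans (le_of_eq ?_)
    rw [hρ]; field_simp
  have a1 : dv ≤ 27 * R₀ * (S * (q ^ 2 * ρ)) + 6 * (m * (q * ρ)) := by
    refine hDV'.trans ?_
    have c1 : ρ ^ 2 ≤ q * ρ := by nlinarith
    have c2 : ρ ^ 3 ≤ q ^ 2 * ρ := by
      have : ρ ^ 2 ≤ q ^ 2 := by gcongr
      nlinarith
    have d1 := mul_le_mul_of_nonneg_left c1 hm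
    have d2 := mul_le_mul_of_nonneg_left c2 (mul_nonneg hS h0.le)
    linarith
  have a2 : 2 * (p * v) ≤
      6 * R₀ * M * (S * (q ^ 2 * ρ)) + 4 * M * (m * (q * ρ)) := by
    have c : p * v ≤ q * M * (m * (2 * ρ) + S * (3 * R₀ * ρ ^ 2)) := by
      gcongr
    have c1 : ρ ^ 2 * q ≤ q ^ 2 * ρ := by
      have : ρ * (q * ρ) ≤ q * (q * ρ) := by gcongr
      linarith
    have d2 := mul_le_mul_of_nonneg_left c1 (mul_nonneg (mul_nonneg hS h0.le) hM)
    linarith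
  have a3 : ps * dp ≤
      2 * R₀ * (3 * M + M') * (S * (q ^ 2 * ρ)) + (3 * M + M') * (m * (q * ρ)) := by
    have c : ps * dp ≤
      (m * (ρ / q) + S * (2 * R₀ * ρ)) * (q ^ 2 * (3 * M + M')) := by
      gcongr
    refine c.trans (le_of_eq ?_)
    field_simp
    ring
  have e1 : q ^ 2 / R = q ^ 2 * ρ := by rw [hρ]; field_simp
  have e3 : q / R = q * ρ := by rw [hρ]; field_simp
  rw [e1, e3]
  have X : 0 ≤ S * (q ^ 2 * ρ) := by positivity
  have Y : 0 ≤ m * (q * ρ) := by positivity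
  have p1 : 0 ≤ (R₀ * (27 + 12 * M + 2 * M')) * (m * (q * ρ)) := by positivity
  have p2 : 0 ≤ (6 + 7 * M + M') * (S * (q ^ 2 * ρ)) := by positivity
  linarith

section
variable {ω : E2 → ℝ} {R₀ R θ : ℝ} {x : E2} {g : ℝ → ℝ}

lemma truncate_eq (hc : Continuous ω) (hs : HasCompactSupport ω) (hg : Differentiable ℝ g)
    (m : ℝ) (hx : x ≠ 0) :
    truncate g θ R ω m x =
      perpL (cutoff g θ R x • VV ω x + streamR ω m R x • pp g (R ^ (-θ)) R x) := by
  refine perpGrad_eq ?_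
  refine ((hasFDerivAt_cutoff hg θ R hx).mul (hasFDerivAt_streamR hc hs m R x)).congr_fderiv ?_
  ext1 v
  simp

lemma hasFDerivAt_main (hc : Continuous ω) (hs : HasCompactSupport ω) (h0 : 0 < R₀)
    (hsupp : ∀ y, ω y ≠ 0 → ‖y‖ ≤ R₀) (hg : Differentiable ℝ g)
    (hg' : Differentiable ℝ (deriv g)) (m : ℝ) (hx : 2 * R₀ < ‖x‖) :
    HasFDerivAt (fun z => biotSavart2D ω z - truncate g θ R ω m z)
      (perpL ∘L (((1 - cutoff g θ R x) • DVV ω x +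
          (-innerSL ℝ (pp g (R ^ (-θ)) R x)).smulRight (VV ω x)) -
        (streamR ω m R x • Dpp g (R ^ (-θ)) R x +
          (innerSL ℝ (VV ω x)).smulRight (pp g (R ^ (-θ)) R x)))) x := by
  have hne : x ≠ 0 := norm_pos_iff.mp (by linarith)
  have h1 := ((hasFDerivAt_cutoff hg θ R hne).const_sub 1).smul
    (hasFDerivAt_VV hc hs h0 hsupp hx)
  have h2 := (hasFDerivAt_streamR hc hs m R x).smul (hasFDerivAt_pp hg' (R ^ (-θ)) R hne)
  have h3 := (perpL.hasFDerivAt (x := _)).comp x (h1.sub h2)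
  refine h3.congr_of_eventuallyEq ?_
  filter_upwards [isOpen_ne.mem_nhds hne] with z hz
  rw [biot_eq hc hs, truncate_eq hc hs hg m hz, ← map_sub]
  simp only [Function.comp_apply, Pi.sub_apply, Pi.smul_apply', sub_smul, one_smul]
  congr 1
  abel

set_option maxHeartbeats 800000 in
lemma norm_main_le (hc : Continuous ω) (hs : HasCompactSupport ω) (h0 : 0 < R₀)
    (hsupp : ∀ y, ω y ≠ 0 → ‖y‖ ≤ R₀) (hg : Differentiable ℝ g)
    (hg' : Differentiable ℝ (deriv g)) (hg01 : ∀ t, g t ∈ Set.Icc (0 : ℝ) 1)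
    {M M' : ℝ} (hR : 4 * R₀ ≤ R) (hx : 3 / 4 * R ≤ ‖x‖) (hx2 : ‖x‖ ≤ R)
    (hq1 : 1 / R ≤ R ^ (-θ)) (hs4 : R ^ (-θ) * (R - ‖x‖) ≤ 1 / 4)
    (h : |deriv g (R ^ (-θ) * (R - ‖x‖))| ≤ M)
    (h' : |deriv (deriv g) (R ^ (-θ) * (R - ‖x‖))| ≤ M') :
    ‖fderiv ℝ (fun z => biotSavart2D ω z - truncate g θ R ω (∫ y, ω y) z) x‖ ≤
      (R₀ * (27 + 12 * M + 2 * M') + (6 + 7 * M + M')) *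
        ((∫ y, |ω y|) * ((R ^ (-θ)) ^ 2 / R) + |∫ y, ω y| * (R ^ (-θ) / R)) := by
  have hRp : 0 < R := by linarith
  have hxp : 0 < ‖x‖ := by linarith
  have hne : x ≠ 0 := norm_pos_iff.mp hxp
  rw [(hasFDerivAt_main hc hs h0 hsupp hg hg' _ (by linarith)).fderiv]
  have hM : 0 ≤ M := (abs_nonneg _).trans h
  have hM' : 0 ≤ M' := (abs_nonneg _).trans h'
  have hq : 0 < R ^ (-θ) := Real.rpow_pos_of_pos hRp _
  have hp := norm_pp_le hq.le hne h
  have hDp := norm_Dpp_le hq.le hne h h'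
  have hV := bound_VV hc hs h0 hsupp hR hx
  have hDV := bound_DVV hc hs h0 hsupp hR hx
  have hψ := bound_streamR hc hs h0 hsupp hR hx hx2
  have hcut : |1 - cutoff g θ R x| ≤ 1 := by
    obtain ⟨h1, h2⟩ := hg01 (R ^ (-θ) * (R - ‖x‖))
    unfold cutoff
    rw [abs_of_nonneg (by linarith)]
    linarith
  set q := R ^ (-θ)
  set S := ∫ y, |ω y|
  set m := |∫ y, ω y|
  have hS : 0 ≤ S := integral_nonneg fun _ => abs_nonneg _
  have hm : 0 ≤ m := abs_nonneg _
  have hstep : ‖perpL ∘L (((1 - cutoff g θ R x) • DVV ω x +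
          (-innerSL ℝ (pp g q R x)).smulRight (VV ω x)) -
        (streamR ω (∫ y, ω y) R x • Dpp g q R x +
          (innerSL ℝ (VV ω x)).smulRight (pp g q R x)))‖ ≤
      ‖DVV ω x‖ + 2 * (‖pp g q R x‖ * ‖VV ω x‖) +
        |streamR ω (∫ y, ω y) R x| * ‖Dpp g q R x‖ := by
    refine (ContinuousLinearMap.opNorm_comp_le _ _).trans ?_
    refine (mul_le_of_le_one_left (norm_nonneg _) norm_perpL_le).trans ?_
    refine (norm_sub_le _ _).trans ?_
    have t1 := norm_add_le ((1 - cutoff g θ R x) • DVV ω x)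
      ((-innerSL ℝ (pp g q R x)).smulRight (VV ω x))
    have t2 := norm_add_le (streamR ω (∫ y, ω y) R x • Dpp g q R x)
      ((innerSL ℝ (VV ω x)).smulRight (pp g q R x))
    rw [norm_smul, ContinuousLinearMap.norm_smulRight_apply, norm_neg, innerSL_apply_norm,
      Real.norm_eq_abs] at t1
    rw [norm_smul, ContinuousLinearMap.norm_smulRight_apply, innerSL_apply_norm,
      Real.norm_eq_abs] at t2
    have t3 := mul_le_of_le_one_left (norm_nonneg (DVV ω x)) hcut
    linarith
  refine hstep.trans ?_
  have hi : ‖x‖⁻¹ ≤ (3 / 4 * R)⁻¹ := inv_anti₀ (by positivity) hx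
  have hρ0 : 0 < 1 / R := by positivity
  have hi' : 2 * ‖x‖⁻¹ ≤ 3 * q := by
    have : (3 / 4 * R)⁻¹ = 4 / 3 * (1 / R) := by field_simp
    linarith
  have e2 : (R - ‖x‖) / (3 / 4 * R) ≤ (1 / R) / q := by
    rw [div_div, div_le_div_iff₀ (by positivity) (by positivity)]
    nlinarith
  exact arith_main hRp hq hq1 hS hm h0 hM hM' (norm_nonneg _) (norm_nonneg _)
    (abs_nonneg _) (norm_nonneg _) hi' e2 hp hDp hV hDV hψ

lemma fderiv_inner (hc : Continuous ω) (hs : HasCompactSupport ω) {δ : ℝ}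
    (hg1 : ∀ t, δ / 2 ≤ t → g t = 1) (m : ℝ)
    (hx : δ / 2 < R ^ (-θ) * (R - ‖x‖)) :
    fderiv ℝ (fun z => biotSavart2D ω z - truncate g θ R ω m z) x = 0 := by
  have hopen : IsOpen {z : E2 | δ / 2 < R ^ (-θ) * (R - ‖z‖)} :=
    isOpen_lt continuous_const (by fun_prop)
  have : (fun z => biotSavart2D ω z - truncate g θ R ω m z) =ᶠ[nhds x] fun _ => (0 : E2) := by
    filter_upwards [hopen.mem_nhds hx] with z hz
    rw [biot_eq hc hs, sub_eq_zero, eq_comm]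
    refine perpGrad_eq ?_
    refine (hasFDerivAt_streamR hc hs m R z).congr_of_eventuallyEq ?_
    filter_upwards [hopen.mem_nhds hz] with w hw
    have hw' : δ / 2 < R ^ (-θ) * (R - ‖w‖) := hw
    simp [cutoff, hg1 _ hw'.le]
  rw [this.fderiv_eq]
  simp

end

lemma volume_layer_le {R a : ℝ} (ha : 0 ≤ a) (haR : a ≤ R) :
    volume (Metric.ball (0 : E2) R \ Metric.ball (0 : E2) (R - a)) ≤
      ENNReal.ofReal (8 * (R * a)) := by
  have hR : 0 ≤ R := ha.trans haR
  rw [measure_sdiff (Metric.ball_subset_ball (by linarith)) measurableSet_ball.nullMeasurableSet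
    measure_ball_lt_top.ne, EuclideanSpace.volume_ball_fin_two,
    EuclideanSpace.volume_ball_fin_two, ← ENNReal.ofReal_pow hR,
    ← ENNReal.ofReal_pow (by linarith), ← ENNReal.ofReal_mul (by positivity),
    ← ENNReal.ofReal_mul (by positivity), ← ENNReal.ofReal_sub _ (by positivity)]
  refine ENNReal.ofReal_le_ofReal ?_
  have h1 : R ^ 2 * π - (R - a) ^ 2 * π = π * (2 * (R * a) - a ^ 2) := by ring
  rw [h1]
  have h2 := Real.pi_le_four
  have h3 : 0 ≤ 2 * (R * a) - a ^ 2 := by nlinarith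
  nlinarith [mul_le_mul_of_nonneg_right h2 h3, sq_nonneg a]

theorem truncation_L2_gradient (R₀ θ δ₁ : ℝ) (hR₀ : 0 < R₀)
    (hθ : θ ∈ Set.Icc (0:ℝ) 1) (hδ₁ : δ₁ ∈ Set.Ioc (0:ℝ) (1/2))
    (g : ℝ → ℝ) (hg : ContDiff ℝ (⊤ : ℕ∞) g)
    (hg01 : ∀ t, g t ∈ Set.Icc (0:ℝ) 1)
    (hg0 : ∀ t ≤ (0:ℝ), g t = 0)
    (hg1 : ∀ t, δ₁ / 2 ≤ t → g t = 1) :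
    ∃ C > 0, ∀ ω : EuclideanSpace ℝ (Fin 2) → ℝ,
      ContDiff ℝ 1 ω →
      Function.support ω ⊆ Metric.closedBall 0 R₀ →
      ∀ R : ℝ, max (4 * R₀) 1 ≤ R →
        eLpNorm
            (fun x => fderiv ℝ
              (fun z => biotSavart2D ω z - truncate g θ R ω (∫ y, ω y) z) x) 2
            (volume.restrict (Metric.ball 0 R)) ≤
          ENNReal.ofReal (C * ((∫ y, |ω y|) * R ^ (-((1 + 3 * θ) / 2)) +
            |∫ y, ω y| * R ^ (-((1 + θ) / 2)))) := by
  obtain ⟨hδ0, hδ1⟩ := hδ₁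
  obtain ⟨hθ0, hθ1⟩ := hθ
  have hgd : Differentiable ℝ g := hg.differentiable (by simp)
  have hg1d : ContDiff ℝ (⊤ : ℕ∞) (deriv g) := by
    have h2 : ContDiff ℝ ((⊤ : ℕ∞) + 1) g := hg
    exact (contDiff_succ_iff_deriv.mp h2).2.2
  have hg2d : ContDiff ℝ (⊤ : ℕ∞) (deriv (deriv g)) := by
    have h2 : ContDiff ℝ ((⊤ : ℕ∞) + 1) (deriv g) := hg1d
    exact (contDiff_succ_iff_deriv.mp h2).2.2
  obtain ⟨M, hM⟩ := (isCompact_Icc (a := (0 : ℝ)) (b := δ₁ / 2)).exists_bound_of_continuousOn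
    hg1d.continuous.continuousOn
  obtain ⟨M', hM'⟩ := (isCompact_Icc (a := (0 : ℝ)) (b := δ₁ / 2)).exists_bound_of_continuousOn
    hg2d.continuous.continuousOn
  have h0mem : (0 : ℝ) ∈ Set.Icc 0 (δ₁ / 2) := ⟨le_rfl, by linarith⟩
  have hMn : 0 ≤ M := (norm_nonneg _).trans (hM 0 h0mem)
  have hMn' : 0 ≤ M' := (norm_nonneg _).trans (hM' 0 h0mem)
  set C0 := R₀ * (27 + 12 * M + 2 * M') + (6 + 7 * M + M') with hC0
  have hC0p : 0 < C0 := by positivity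
  refine ⟨2 * C0, by positivity, fun ω hω hsupp R hR => ?_⟩
  have hc : Continuous ω := hω.continuous
  have hs : HasCompactSupport ω :=
    HasCompactSupport.of_support_subset_isCompact (isCompact_closedBall 0 R₀) hsupp
  have hsupp' : ∀ y, ω y ≠ 0 → ‖y‖ ≤ R₀ := fun y hy => by
    simpa using hsupp (Function.mem_support.mpr hy)
  have hR4 : 4 * R₀ ≤ R := (le_max_left _ _).trans hR
  have hR1 : 1 ≤ R := (le_max_right _ _).trans hR
  have hRp : 0 < R := by linarith
  have hq : 0 < R ^ (-θ) := Real.rpow_pos_of_pos hRp _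
  have hqi : R ^ (-θ) * R ^ θ = 1 := by
    rw [← Real.rpow_add hRp]; simp
  have hq1 : 1 / R ≤ R ^ (-θ) := by
    rw [one_div, ← Real.rpow_neg_one]
    exact Real.rpow_le_rpow_of_exponent_le hR1 (by linarith)
  have hRθ : R ^ θ ≤ R := by
    calc R ^ θ ≤ R ^ (1 : ℝ) := Real.rpow_le_rpow_of_exponent_le hR1 hθ1
      _ = R := Real.rpow_one R
  have hRθ0 : 0 < R ^ θ := Real.rpow_pos_of_pos hRp _
  set a := δ₁ / 2 * R ^ θ with ha
  have ha0 : 0 ≤ a := by positivity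
  have ha4 : a ≤ 1 / 4 * R ^ θ := by exact mul_le_mul_of_nonneg_right (by linarith) hRθ0.le
  have haR : a ≤ 1 / 4 * R := by linarith
  have hqa : R ^ (-θ) * a = δ₁ / 2 := by
    rw [ha]; linear_combination (δ₁ / 2) * hqi
  set A : Set E2 := Metric.ball (0 : E2) R \ Metric.ball (0 : E2) (R - a) with hA
  set S := ∫ y, |ω y|
  have hS : 0 ≤ S := integral_nonneg fun _ => abs_nonneg _
  set K := C0 * (S * ((R ^ (-θ)) ^ 2 / R) + |∫ y, ω y| * (R ^ (-θ) / R)) with hK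
  have hK0 : 0 ≤ K := by positivity
  have hpt : ∀ x ∈ Metric.ball (0 : E2) R,
      ‖fderiv ℝ (fun z => biotSavart2D ω z - truncate g θ R ω (∫ y, ω y) z) x‖ ≤
        ‖A.indicator (fun _ => K) x‖ := by
    intro x hx
    have hxR : ‖x‖ < R := by simpa using hx
    by_cases hxa : x ∈ Metric.ball (0 : E2) (R - a)
    · have hxa' : ‖x‖ < R - a := by simpa using hxa
      rw [fderiv_inner hc hs hg1]
      · simp
      · rw [← hqa]
        exact mul_lt_mul_of_pos_left (by linarith) hq
    · have hxa' : R - a ≤ ‖x‖ := by simpa using hxa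
      rw [Set.indicator_of_mem (show x ∈ A from ⟨hx, hxa⟩), Real.norm_of_nonneg hK0]
      have hle : R ^ (-θ) * (R - ‖x‖) ≤ δ₁ / 2 := by
        rw [← hqa]
        exact mul_le_mul_of_nonneg_left (by linarith) hq.le
      have hmem : R ^ (-θ) * (R - ‖x‖) ∈ Set.Icc 0 (δ₁ / 2) :=
        ⟨mul_nonneg hq.le (by linarith), hle⟩
      exact norm_main_le hc hs hR₀ hsupp' hgd (hg1d.differentiable (by simp)) hg01 hR4
        (by linarith) hxR.le hq1 (by linarith) (hM _ hmem) (hM' _ hmem)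
  have hAm : MeasurableSet A := measurableSet_ball.diff measurableSet_ball
  have hvol : (volume.restrict (Metric.ball (0 : E2) R)) A ≤
      ENNReal.ofReal ((2 * R ^ ((1 + θ) / 2)) ^ 2) := by
    refine (Measure.restrict_apply_le _ _).trans
      ((volume_layer_le ha0 (by linarith)).trans (ENNReal.ofReal_le_ofReal ?_))
    have e : (R ^ ((1 + θ) / 2)) ^ 2 = R * R ^ θ := by
      rw [← Real.rpow_natCast, ← Real.rpow_mul hRp.le]
      push_cast
      rw [div_mul_cancel₀ _ (by norm_num), Real.rpow_add hRp, Real.rpow_one]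
    rw [mul_pow, e]
    nlinarith [mul_le_mul_of_nonneg_left ha4 hRp.le, mul_pos hRp hRθ0]
  have hh : 0 < R ^ ((1 + θ) / 2) := Real.rpow_pos_of_pos hRp _
  calc _ ≤ eLpNorm (A.indicator (fun _ => K)) 2 (volume.restrict (Metric.ball (0 : E2) R)) := by
        refine eLpNorm_mono_ae ?_
        filter_upwards [ae_restrict_mem measurableSet_ball] with x hx using hpt x hx
    _ = ENNReal.ofReal K * ((volume.restrict (Metric.ball (0 : E2) R)) A) ^ (1 / 2 : ℝ) := by
        rw [eLpNorm_indicator_const hAm (by norm_num) (by norm_num),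
          Real.enorm_of_nonneg hK0]
        norm_num
    _ ≤ ENNReal.ofReal K * (ENNReal.ofReal ((2 * R ^ ((1 + θ) / 2)) ^ 2)) ^ (1 / 2 : ℝ) := by
        gcongr
    _ = ENNReal.ofReal (K * (2 * R ^ ((1 + θ) / 2))) := by
        rw [ENNReal.ofReal_rpow_of_nonneg (by positivity) (by norm_num), ← Real.sqrt_eq_rpow,
          Real.sqrt_sq (by positivity), ← ENNReal.ofReal_mul hK0]
    _ = _ := by
        congr 1
        have e1 : R ^ (-((1 + 3 * θ) / 2)) = (R ^ (-θ)) ^ 2 / R * R ^ ((1 + θ) / 2) := by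
          rw [← Real.rpow_natCast, ← Real.rpow_mul hRp.le]
          nth_rewrite 3 [← Real.rpow_one R]
          rw [← Real.rpow_sub hRp, ← Real.rpow_add hRp]
          congr 1
          push_cast
          ring
        have e2 : R ^ (-((1 + θ) / 2)) = R ^ (-θ) / R * R ^ ((1 + θ) / 2) := by
          nth_rewrite 3 [← Real.rpow_one R]
          rw [← Real.rpow_sub hRp, ← Real.rpow_add hRp]
          congr 1
          ring
        rw [e1, e2, hK]
        ring
end
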